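/- Let 0 ≤ α < 1/2, let p_1,p_2,p_3 satisfy 3/(1−α) < p_i ≤ ∞ with (1+α)/2 < (p_i−1)/p_i for i=1,2, and Σ_{i=1}^{3} 1/p_i ≤ 1−α, and set r = √(x_1²+x_2²). Then there exists a constant C>0 such that for all f ∈ C_0^∞(ℝ³), ‖ f / r^{(1+α)/2} ‖_{L^{2p_3/(p_3−1),2}_{x_3} L^{2p_2/(p_2−1),2}_{x_2} L^{2p_1/(p_1−1),2}_{x_1}(ℝ³)} ≤ C ‖ f ‖_{L^2(ℝ³)}^{(1−α−Σ_i 1/p_i)/2} ‖ ∇f ‖_{L^2(ℝ³)}^{(1+α+Σ_i 1/p_i)/2}, where the mixed Lorentz norm is taken with the L^{2p_1/(p_1−1),2} quasi-norm in x_1 innermost, then x_2, then x_3. -/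

import Mathlib

open MeasureTheory ENNReal Real Set

noncomputable section

/-- The decreasing rearrangement of an `ℝ≥0∞`-valued function. -/
def rearr {α : Type*} [MeasurableSpace α] (μ : Measure α) (f : α → ℝ≥0∞) (t : ℝ) : ℝ≥0∞ :=
  sInf {s : ℝ≥0∞ | μ {x | s < f x} ≤ ENNReal.ofReal t}

/-- The Lorentz `L^{p,q}` quasi-norm, `‖f‖_{p,q} = ‖ t^{1/p} f*(t) ‖_{L^q((0,∞),dt/t)}`,
with `q = ∞` giving the weak-`L^p` quasi-norm. -/
def lorentzNorm {α : Type*} [MeasurableSpace α] (μ : Measure α) (p q : ℝ≥0∞)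
    (f : α → ℝ≥0∞) : ℝ≥0∞ :=
  if q = ∞ then ⨆ t ∈ Set.Ioi (0 : ℝ), ENNReal.ofReal t ^ p⁻¹.toReal * rearr μ f t
  else (∫⁻ t in Set.Ioi (0 : ℝ),
      (ENNReal.ofReal t ^ p⁻¹.toReal * rearr μ f t) ^ q.toReal / ENNReal.ofReal t) ^ q⁻¹.toReal

/-- Mixed (anisotropic) Lorentz quasi-norm on `ℝⁿ`: the Lorentz quasi-norm is taken
iteratively in each coordinate, with the coordinate `x 0` innermost. -/
def mixedLorentz : (n : ℕ) → (Fin n → ℝ≥0∞) → (Fin n → ℝ≥0∞) →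
    ((Fin n → ℝ) → ℝ≥0∞) → ℝ≥0∞
  | 0, _, _, f => f (fun i => i.elim0)
  | n + 1, p, q, f => mixedLorentz n (fun i => p i.succ) (fun i => q i.succ)
      (fun y => lorentzNorm (volume : Measure ℝ) (p 0) (q 0) (fun x => f (Fin.cons x y)))

/-- Mixed (anisotropic) Lebesgue norm on `ℝⁿ`, coordinate `x 0` innermost. -/
def mixedLp : (n : ℕ) → (Fin n → ℝ) → ((Fin n → ℝ) → ℝ≥0∞) → ℝ≥0∞
  | 0, _, f => f (fun i => i.elim0)
  | n + 1, p, f => mixedLp n (fun i => p i.succ)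
      (fun y => (∫⁻ x : ℝ, (f (Fin.cons x y)) ^ (p 0)) ^ (1 / p 0))

/-- The Fourier transform on `ℝⁿ`, normalized as `(2π)^{-n/2} ∫ f(x) e^{-i ξ·x} dx`. -/
def ft (n : ℕ) (f : (Fin n → ℝ) → ℂ) (ξ : Fin n → ℝ) : ℂ :=
  (((2 * π) ^ (-(n : ℝ) / 2) : ℝ) : ℂ) *
    ∫ x : Fin n → ℝ, Complex.exp (-(Complex.I * ((∑ i, ξ i * x i : ℝ) : ℂ))) * f x

/-- `Λ^s` acting only in the coordinates of `S`: the Fourier multiplier with symbol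
`(∑_{i ∈ S} |ξ i|²)^{s/2}`. -/
def fracLapOn (n : ℕ) (S : Finset (Fin n)) (s : ℝ) (f : (Fin n → ℝ) → ℂ)
    (x : Fin n → ℝ) : ℂ :=
  ft n (fun ξ => ((((∑ i ∈ S, ξ i ^ 2) ^ (s / 2) : ℝ)) : ℂ) * ft n f ξ) (-x)

/-- The fractional Laplacian `Λ^s = (−Δ)^{s/2}`. -/
def fracLap (n : ℕ) (s : ℝ) (f : (Fin n → ℝ) → ℂ) : (Fin n → ℝ) → ℂ :=
  fracLapOn n Finset.univ s f


/-! ### Rearrangement lemmas -/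

lemma rearr_spec {α : Type*} [MeasurableSpace α] (μ : Measure α) (f : α → ℝ≥0∞) (t : ℝ) :
    μ {x | rearr μ f t < f x} ≤ ENNReal.ofReal t := by
  set S := {s : ℝ≥0∞ | μ {x | s < f x} ≤ ENNReal.ofReal t} with hS
  have hne : S.Nonempty := ⟨⊤, by simp [hS]⟩
  obtain ⟨u, hu, hlim, humem⟩ := exists_seq_tendsto_sInf hne (OrderBot.bddBelow S)
  have hset : {x | rearr μ f t < f x} = ⋃ n, {x | u n < f x} := by
    ext x
    simp only [mem_ofPred_eq, mem_iUnion]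
    constructor
    · intro h
      exact ((hlim.eventually (gt_mem_nhds h))).exists
    · rintro ⟨n, hn⟩
      exact lt_of_le_of_lt (sInf_le (humem n)) hn
  rw [hset, Directed.measure_iUnion]
  · exact iSup_le fun n => humem n
  · apply Monotone.directed_le
    intro m n hmn x hx
    exact lt_of_le_of_lt (hu hmn) hx

lemma rearr_le {α : Type*} [MeasurableSpace α] {μ : Measure α} {f : α → ℝ≥0∞} {t : ℝ} {s : ℝ≥0∞}
    (h : μ {x | s < f x} ≤ ENNReal.ofReal t) : rearr μ f t ≤ s := sInf_le h

lemma lt_meas_of_lt_rearr {α : Type*} [MeasurableSpace α] {μ : Measure α} {f : α → ℝ≥0∞} {t : ℝ}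
    {s : ℝ≥0∞} (h : s < rearr μ f t) : ENNReal.ofReal t < μ {x | s < f x} := by
  by_contra hc
  exact absurd (rearr_le (not_lt.mp hc)) (not_le.mpr h)

lemma rearr_antitone {α : Type*} [MeasurableSpace α] (μ : Measure α) (f : α → ℝ≥0∞) :
    Antitone (rearr μ f) := by
  intro a b hab
  exact rearr_le ((rearr_spec μ f a).trans (ENNReal.ofReal_le_ofReal hab))

lemma rearr_measurable {α : Type*} [MeasurableSpace α] (μ : Measure α) (f : α → ℝ≥0∞) :
    Measurable (rearr μ f) := (rearr_antitone μ f).measurable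

lemma rearr_mono {α : Type*} [MeasurableSpace α] (μ : Measure α) {f g : α → ℝ≥0∞}
    (h : ∀ x, f x ≤ g x) (t : ℝ) : rearr μ f t ≤ rearr μ g t :=
  rearr_le ((measure_mono fun _ hx => lt_of_lt_of_le hx (h _)).trans (rearr_spec μ g t))

lemma rearr_const_mul {α : Type*} [MeasurableSpace α] (μ : Measure α) (f : α → ℝ≥0∞) (c : ℝ≥0∞)
    (t : ℝ) : rearr μ (fun x => c * f x) t ≤ c * rearr μ f t := by
  refine rearr_le ((measure_mono fun x hx => ?_).trans (rearr_spec μ f t))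
  by_contra hc
  exact absurd (mul_le_mul_right (not_lt.mp hc) c) (not_le.mpr hx)

lemma rearr_weight (a : ℝ) (ha : 0 ≤ a) (g : ℝ → ℝ≥0∞) (t : ℝ) (ht : 0 < t) :
    rearr volume (fun x => ENNReal.ofReal |x| ^ (-a) * g x) t
      ≤ ENNReal.ofReal (t / 4) ^ (-a) * rearr volume g (t / 2) := by
  apply rearr_le
  have hsub : {x : ℝ | ENNReal.ofReal (t / 4) ^ (-a) * rearr volume g (t / 2)
      < ENNReal.ofReal |x| ^ (-a) * g x} ⊆
      Ioo (-(t/4)) (t/4) ∪ {x | rearr volume g (t / 2) < g x} := by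
    intro x hx
    by_contra hc
    simp only [mem_union, not_or, mem_ofPred_eq, not_lt] at hc
    obtain ⟨h1, h2⟩ := hc
    have h3 : t / 4 ≤ |x| := by
      by_contra h; exact h1 (abs_lt.mp (not_le.mp h))
    have : ENNReal.ofReal |x| ^ (-a) ≤ ENNReal.ofReal (t / 4) ^ (-a) := by
      rw [ENNReal.rpow_neg, ENNReal.rpow_neg]
      exact ENNReal.inv_le_inv.mpr (ENNReal.rpow_le_rpow (ENNReal.ofReal_le_ofReal h3) ha)
    exact absurd (mul_le_mul' this h2) (not_le.mpr hx)
  refine (measure_mono hsub).trans ((measure_union_le _ _).trans ?_)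
  refine (add_le_add_right (rearr_spec volume g (t/2)) _).trans ?_
  rw [Real.volume_Ioo, ← ENNReal.ofReal_add (by linarith) (by linarith)]
  apply ENNReal.ofReal_le_ofReal; linarith

/-- Scaling on the half line. -/
lemma lintegral_Ioi_scale (c : ℝ) (hc : 0 < c) (φ : ℝ → ℝ≥0∞) :
    ∫⁻ t in Ioi (0:ℝ), φ (c * t) = ENNReal.ofReal c⁻¹ * ∫⁻ t in Ioi (0:ℝ), φ t := by
  have hpre : (fun t : ℝ => c * t) ⁻¹' (Ioi 0) = Ioi 0 := by
    ext t; simp [hc]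
  have e := (Homeomorph.mulLeft₀ c hc.ne').toMeasurableEquiv
  have hm : MeasurableEmbedding (fun t : ℝ => c * t) :=
    (Homeomorph.mulLeft₀ c hc.ne').measurableEmbedding
  have h1 := hm.lintegral_map (μ := volume) ((Ioi (0:ℝ)).indicator φ)
  rw [Real.map_volume_mul_left hc.ne', lintegral_smul_measure,
    lintegral_indicator measurableSet_Ioi, abs_of_pos (inv_pos.mpr hc)] at h1
  rw [← lintegral_indicator measurableSet_Ioi, ← smul_eq_mul, h1]
  congr 1
  ext t
  simp [indicator, hc]

/-- Layer cake for squares. -/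
lemma sq_layer (z : ℝ≥0∞) :
    ∫⁻ s in Ioi (0:ℝ), (if ENNReal.ofReal s < z then ENNReal.ofReal (2 * s) else 0) = z ^ 2 := by
  have key : ∀ r : ℝ, 0 ≤ r → ∫⁻ s in Ioi (0:ℝ),
      (if ENNReal.ofReal s < ENNReal.ofReal r then ENNReal.ofReal (2 * s) else 0)
        = ENNReal.ofReal r ^ 2 := by
    intro r hr
    have : ∀ s ∈ Ioi (0:ℝ), (if ENNReal.ofReal s < ENNReal.ofReal r then ENNReal.ofReal (2 * s)
        else 0) = (Iio r).indicator (fun s => ENNReal.ofReal (2 * s)) s := by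
      intro s hs
      simp only [indicator, mem_Iio]
      simp only [ENNReal.ofReal_lt_ofReal_iff_of_nonneg (le_of_lt hs)]
    rw [setLIntegral_congr_fun measurableSet_Ioi this, lintegral_indicator measurableSet_Iio,
      Measure.restrict_restrict measurableSet_Iio, inter_comm, Ioi_inter_Iio,
      Measure.restrict_congr_set Ioo_ae_eq_Ioc,
      ← ofReal_integral_eq_lintegral_ofReal, ← intervalIntegral.integral_of_le hr]
    · rw [← ENNReal.ofReal_pow hr]; congr 1
      rw [intervalIntegral.integral_const_mul, integral_id]; ring
    · exact (Continuous.integrableOn_Icc (by fun_prop)).mono_set Ioc_subset_Icc_self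
    · filter_upwards [ae_restrict_mem measurableSet_Ioc] with s hs
      have := hs.1; simp; linarith
  by_cases hz : z = ⊤
  · subst hz
    rw [ENNReal.top_pow (by norm_num)]
    refine ENNReal.eq_top_of_forall_nnreal_le ?_
    intro r
    have h1 := key (max r 1) (by positivity)
    calc (r : ℝ≥0∞) ≤ ENNReal.ofReal (max r 1) ^ 2 := by
          rw [← ENNReal.ofReal_pow (by positivity), ← ENNReal.ofReal_coe_nnreal]
          apply ENNReal.ofReal_le_ofReal
          nlinarith [le_max_left (r:ℝ) 1, le_max_right (r:ℝ) 1]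
      _ ≤ _ := by
          rw [← h1]
          apply lintegral_mono
          intro s
          dsimp only
          rw [if_pos ENNReal.ofReal_lt_top]
          split_ifs <;> simp
  · rw [← ENNReal.ofReal_toReal hz]; exact key _ ENNReal.toReal_nonneg

lemma rearr_sq_le (g : ℝ → ℝ≥0∞) (hg : Measurable g) :
    ∫⁻ t in Ioi (0:ℝ), rearr volume g t ^ 2 ≤ ∫⁻ x, g x ^ 2 := by
  have h1 : ∀ {β : Type} [MeasurableSpace β] (μ : Measure β) [SFinite μ] (k : β → ℝ≥0∞)
      (hk : Measurable k), ∫⁻ x, k x ^ 2 ∂μ =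
      ∫⁻ s in Ioi (0:ℝ), ENNReal.ofReal (2 * s) * μ {x | ENNReal.ofReal s < k x} := by
    intro β _ μ _ k hk
    simp_rw [← sq_layer]
    rw [lintegral_lintegral_swap]
    · congr 1; ext s
      have hm : MeasurableSet {x | ENNReal.ofReal s < k x} := measurableSet_lt (by fun_prop) hk
      rw [← lintegral_indicator_const hm]
      congr 1
      ext x
      simp [indicator]
    · apply Measurable.aemeasurable
      apply Measurable.ite
      · exact measurableSet_lt (by fun_prop) (by fun_prop)
      · fun_prop
      · fun_prop
  rw [h1 _ _ (rearr_measurable volume g), h1 _ _ hg]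
  apply lintegral_mono
  intro s
  dsimp only
  refine mul_le_mul_right ?_ _
  rw [Measure.restrict_apply (measurableSet_lt (by fun_prop) (rearr_measurable volume g))]
  set m := volume {x | ENNReal.ofReal s < g x}
  by_cases hm : m = ⊤
  · rw [hm]; exact le_top
  calc _ ≤ volume (Ioo 0 m.toReal) := by
        apply measure_mono
        rintro t ⟨h1, h2⟩
        refine ⟨h2, ?_⟩
        have := lt_meas_of_lt_rearr h1
        exact (ENNReal.ofReal_lt_iff_lt_toReal (le_of_lt h2) hm).mp this
    _ = m := by rw [Real.volume_Ioo, sub_zero, ENNReal.ofReal_toReal hm]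

/-! ### Power integrals and the one-dimensional estimate -/

lemma lintegral_pow_Ioi (b c : ℝ) (hb : b < -1) (hc : 0 < c) :
    ∫⁻ t in Ioi c, ENNReal.ofReal t ^ b = ENNReal.ofReal (-c ^ (b + 1) / (b + 1)) := by
  rw [← integral_Ioi_rpow_of_lt hb hc, ofReal_integral_eq_lintegral_ofReal]
  · apply setLIntegral_congr_fun measurableSet_Ioi
    intro t ht
    exact ENNReal.ofReal_rpow_of_pos (hc.trans ht)
  · exact integrableOn_Ioi_rpow_of_lt hb hc
  · filter_upwards [ae_restrict_mem measurableSet_Ioi] with t ht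
    exact Real.rpow_nonneg (hc.trans ht).le _

lemma lintegral_pow_Ioc (b c : ℝ) (hb : -1 < b) (hc : 0 ≤ c) :
    ∫⁻ t in Ioc 0 c, ENNReal.ofReal t ^ b = ENNReal.ofReal (c ^ (b + 1) / (b + 1)) := by
  have h1 := integral_rpow (a := 0) (b := c) (r := b) (Or.inl hb)
  rw [Real.zero_rpow (by linarith), sub_zero, intervalIntegral.integral_of_le hc] at h1
  rw [← h1, ofReal_integral_eq_lintegral_ofReal]
  · apply setLIntegral_congr_fun measurableSet_Ioc
    intro t ht
    exact ENNReal.ofReal_rpow_of_pos ht.1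
  · exact (intervalIntegrable_iff_integrableOn_Ioc_of_le hc).mp
      (intervalIntegral.intervalIntegrable_rpow' hb)
  · filter_upwards [ae_restrict_mem measurableSet_Ioc] with t ht
    exact Real.rpow_nonneg ht.1.le _

lemma core_step (g : ℝ → ℝ≥0∞) (hg : Measurable g) (D : ℝ → ℝ → ℝ≥0∞)
    (hD : Measurable (Function.uncurry D))
    (hgD : ∀ h x, g x ≤ g (x + h) + D h x) (l t : ℝ) (hl : 0 < l) (ht : 0 < t) :
    rearr volume g t ≤ rearr volume g (l * t) +
      ((ENNReal.ofReal (l * t * t))⁻¹ * ∫⁻ h in Ioc 0 (2 * (l * t)), ∫⁻ x, D h x ^ 2)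
        ^ (1 / 2 : ℝ) := by
  refine le_of_forall_lt_imp_le_of_dense fun s hs => ?_
  rw [← tsub_le_iff_left]
  set d := s - rearr volume g (l * t) with hd
  have hlt : 0 < l * t := mul_pos hl ht
  have hltt : 0 < l * t * t := mul_pos hlt ht
  have hE := lt_meas_of_lt_rearr hs
  have hEm : MeasurableSet {x | s < g x} := measurableSet_lt measurable_const hg
  have hFm : MeasurableSet {x | rearr volume g (l * t) < g x} :=
    measurableSet_lt measurable_const hg
  have hF := rearr_spec volume g (l * t)
  have hmain : d ^ 2 * ENNReal.ofReal (l * t * t) ≤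
      ∫⁻ h in Ioc 0 (2 * (l * t)), ∫⁻ x, D h x ^ 2 := by
    rw [lintegral_lintegral_swap (by exact (hD.pow_const 2).aemeasurable)]
    calc d ^ 2 * ENNReal.ofReal (l * t * t)
        ≤ (d ^ 2 * ENNReal.ofReal (l * t)) * volume {x | s < g x} := by
          rw [ENNReal.ofReal_mul hlt.le, ← mul_assoc]
          gcongr
      _ = ∫⁻ x in {x | s < g x}, (d ^ 2 * ENNReal.ofReal (l * t)) := by
          rw [setLIntegral_const]
      _ ≤ ∫⁻ x in {x | s < g x}, ∫⁻ h in Ioc 0 (2 * (l * t)), D h x ^ 2 := by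
          apply setLIntegral_mono' hEm
          intro x hx
          set A := Ioc 0 (2 * (l * t)) \ (fun h => x + h) ⁻¹' {x | rearr volume g (l * t) < g x}
            with hA
          have hAm : MeasurableSet A := measurableSet_Ioc.diff (hFm.preimage (by fun_prop))
          have hAv : ENNReal.ofReal (l * t) ≤ volume A := by
            refine le_trans ?_ le_measure_sdiff
            rw [measure_preimage_add, Real.volume_Ioc]
            refine le_trans ?_ (tsub_le_tsub_left hF _)
            rw [← ENNReal.ofReal_sub _ hlt.le]
            apply ENNReal.ofReal_le_ofReal; linarith
          calc d ^ 2 * ENNReal.ofReal (l * t) ≤ d ^ 2 * volume A := by gcongr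
            _ = ∫⁻ h in A, d ^ 2 := by rw [setLIntegral_const]
            _ ≤ ∫⁻ h in A, D h x ^ 2 := by
                apply setLIntegral_mono' hAm
                intro h hh
                have h1 : g (x + h) ≤ rearr volume g (l * t) := not_lt.mp hh.2
                gcongr
                rw [hd, tsub_le_iff_left]
                exact (le_of_lt hx).trans ((hgD h x).trans (by gcongr))
            _ ≤ _ := lintegral_mono_set sdiff_subset
      _ ≤ _ := setLIntegral_le_lintegral _ _
  have h2 : d ^ 2 ≤ (ENNReal.ofReal (l * t * t))⁻¹ *
      ∫⁻ h in Ioc 0 (2 * (l * t)), ∫⁻ x, D h x ^ 2 := by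
    rw [mul_comm (ENNReal.ofReal _)⁻¹, ← div_eq_mul_inv]
    rw [ENNReal.le_div_iff_mul_le (Or.inl (by simpa using hltt)) (Or.inl ENNReal.ofReal_ne_top)]
    exact hmain
  calc d = (d ^ 2) ^ (1 / 2 : ℝ) := by
        rw [← ENNReal.rpow_two, ← ENNReal.rpow_mul]; norm_num
    _ ≤ _ := ENNReal.rpow_le_rpow h2 (by norm_num)

lemma ennreal_add_sq_le (a b : ℝ≥0∞) : (a + b) ^ 2 ≤ 2 * a ^ 2 + 2 * b ^ 2 := by
  have := ENNReal.rpow_add_le_mul_rpow_add_rpow a b (p := 2) (by norm_num)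
  norm_num at this
  simpa [mul_add] using this

lemma ofReal_rpow_mul (c : ℝ) (hc : 0 < c) (t b : ℝ) (ht : 0 < t) :
    ENNReal.ofReal (c * t) ^ b = ENNReal.ofReal (c ^ b) * ENNReal.ofReal t ^ b := by
  rw [ENNReal.ofReal_rpow_of_pos (by positivity), ENNReal.ofReal_rpow_of_pos ht,
    Real.mul_rpow hc.le ht.le, ENNReal.ofReal_mul (by positivity)]

/-- The one-dimensional estimate at the level of the rearrangement. -/
lemma core_rearr (s : ℝ) (hs0 : 0 < s) (hs : s < 1 / 2) : ∃ C : ℝ, 0 < C ∧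
    ∀ (g : ℝ → ℝ≥0∞) (D : ℝ → ℝ → ℝ≥0∞) (R : ℝ), Measurable g →
    Measurable (Function.uncurry D) → (∀ h x, g x ≤ g (x + h) + D h x) →
    (∀ x, R < |x| → g x = 0) →
    ∫⁻ t in Ioi (0:ℝ), ENNReal.ofReal t ^ (-(2 * s)) * rearr volume g t ^ 2 ≤
      ENNReal.ofReal C *
        ∫⁻ h in Ioi (0:ℝ), ENNReal.ofReal h ^ (-1 - 2 * s) * ∫⁻ x, D h x ^ 2 := by
  set l : ℝ := 4 ^ (1 / (1 - 2 * s)) with hl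
  have hl0 : 0 < l := by positivity
  have hls : l ^ (2 * s - 1) = 1 / 4 := by
    rw [hl, ← Real.rpow_mul (by norm_num), show 1 / (1 - 2 * s) * (2 * s - 1) = -1 by
      rw [div_mul_eq_mul_div, div_eq_iff (by linarith)]; ring, Real.rpow_neg_one]; norm_num
  set c1 : ℝ := 2 * l⁻¹ * ((2 * l)⁻¹ ^ (-1 - 2 * s) / (1 + 2 * s)) with hc1
  have hc1p : 0 < c1 := by positivity
  refine ⟨2 * c1, by positivity, ?_⟩
  intro g D R hg hD hgD hR
  set ω : ℝ → ℝ≥0∞ := fun h => ∫⁻ x, D h x ^ 2 with hω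
  have hωm : Measurable ω := (hD.pow_const 2).lintegral_prod_right'
  set J : ℝ → ℝ≥0∞ := fun t => (ENNReal.ofReal (l * t * t))⁻¹ * ∫⁻ h in Ioc 0 (2 * (l * t)), ω h
    with hJ
  set W : ℝ≥0∞ := ∫⁻ h in Ioi (0:ℝ), ENNReal.ofReal h ^ (-1 - 2 * s) * ω h with hW
  -- vanishing of the rearrangement for large t
  have hvan : ∀ t, 2 * |R| ≤ t → rearr volume g t = 0 := by
    intro t ht
    refine le_antisymm (rearr_le ?_) bot_le
    refine (measure_mono (t := Icc (-|R|) |R|) ?_).trans ?_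
    · intro x hx
      by_contra hc
      have : R < |x| := by
        by_contra h
        exact hc (abs_le.mp ((not_lt.mp h).trans (le_abs_self R)))
      exact absurd (hR x this) (ne_of_gt hx)
    · rw [Real.volume_Icc]; apply ENNReal.ofReal_le_ofReal; linarith
  -- the tail integral
  have htail : ∫⁻ t in Ioi (0:ℝ), ENNReal.ofReal t ^ (-(2 * s)) * (2 * J t) ≤
      ENNReal.ofReal c1 * W := by
    have e1 : ∀ t ∈ Ioi (0:ℝ), ENNReal.ofReal t ^ (-(2 * s)) * (2 * J t) =
        ∫⁻ h in Ioi (0:ℝ), (if h ≤ 2 * (l * t) then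
          ENNReal.ofReal (2 * l⁻¹) * ENNReal.ofReal t ^ (-2 - 2 * s) * ω h else 0) := by
      intro t ht
      have ht' : (0:ℝ) < t := ht
      have : ∀ h, (if h ≤ 2 * (l * t) then
          ENNReal.ofReal (2 * l⁻¹) * ENNReal.ofReal t ^ (-2 - 2 * s) * ω h else 0) =
          (Iic (2 * (l * t))).indicator (fun h =>
            ENNReal.ofReal (2 * l⁻¹) * ENNReal.ofReal t ^ (-2 - 2 * s) * ω h) h := by
        intro h; simp [indicator]
      simp_rw [this]
      rw [lintegral_indicator measurableSet_Iic, Measure.restrict_restrict measurableSet_Iic,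
        inter_comm, Ioi_inter_Iic, lintegral_const_mul _ hωm]
      simp only [hJ]
      rw [← mul_assoc, ← mul_assoc]
      congr 1
      rw [ENNReal.ofReal_rpow_of_pos ht', ENNReal.ofReal_rpow_of_pos ht',
        ← ENNReal.ofReal_inv_of_pos (by positivity),
        show (2 : ℝ≥0∞) = ENNReal.ofReal 2 by simp,
        ← ENNReal.ofReal_mul (by positivity), ← ENNReal.ofReal_mul (by positivity),
        ← ENNReal.ofReal_mul (by positivity)]
      congr 1
      rw [show -2 - 2 * s = -(2 * s) - (2 : ℕ) by push_cast; ring,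
        Real.rpow_sub_natCast ht'.ne']
      field_simp
    rw [setLIntegral_congr_fun measurableSet_Ioi e1, lintegral_lintegral_swap]
    · rw [hW, ← lintegral_const_mul _ (by fun_prop)]
      apply setLIntegral_mono' measurableSet_Ioi
      intro h hh
      have hh' : (0:ℝ) < h := hh
      have : ∀ t, (if h ≤ 2 * (l * t) then
          ENNReal.ofReal (2 * l⁻¹) * ENNReal.ofReal t ^ (-2 - 2 * s) * ω h else 0) =
          (Ici ((2 * l)⁻¹ * h)).indicator (fun t =>
            (ENNReal.ofReal (2 * l⁻¹) * ω h) * ENNReal.ofReal t ^ (-2 - 2 * s)) t := by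
        intro t
        simp only [indicator, mem_Ici]
        have : h ≤ 2 * (l * t) ↔ (2 * l)⁻¹ * h ≤ t := by
          rw [inv_mul_le_iff₀ (by positivity)]; ring_nf
        simp only [this]
        split_ifs
        · ring
        · rfl
      simp_rw [this]
      have hp : 0 < (2 * l)⁻¹ * h := by positivity
      rw [lintegral_indicator measurableSet_Ici, Measure.restrict_restrict measurableSet_Ici,
        inter_eq_left.mpr (show Ici ((2 * l)⁻¹ * h) ⊆ Ioi 0 from fun x hx => lt_of_lt_of_le hp hx), lintegral_const_mul _ (by fun_prop),
        Measure.restrict_congr_set Ioi_ae_eq_Ici.symm, lintegral_pow_Ioi _ _ (by linarith) hp,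
        ENNReal.ofReal_rpow_of_pos hh', mul_right_comm, ← mul_assoc,
        ← ENNReal.ofReal_mul (by positivity), ← ENNReal.ofReal_mul (by positivity)]
      apply le_of_eq
      congr 2
      rw [show -2 - 2 * s + 1 = -1 - 2 * s by ring, Real.mul_rpow (by positivity) hh'.le, hc1]
      have : -1 - 2 * s = -(1 + 2 * s) := by ring
      generalize (2 * l)⁻¹ ^ (-1 - 2 * s) = A
      generalize h ^ (-1 - 2 * s) = B
      rw [this, neg_div_neg_eq]; ring
    · apply Measurable.aemeasurable
      apply Measurable.ite
      · exact measurableSet_le (by fun_prop) (by fun_prop)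
      · fun_prop
      · fun_prop
  -- the truncated inequality
  have htrunc : ∀ M : ℕ, ∫⁻ t in Ioi (0:ℝ), ENNReal.ofReal t ^ (-(2 * s)) *
      (min (rearr volume g t) M) ^ 2 ≤ ENNReal.ofReal (2 * c1) * W := by
    intro M
    set X := ∫⁻ t in Ioi (0:ℝ), ENNReal.ofReal t ^ (-(2 * s)) * (min (rearr volume g t) M) ^ 2
      with hX
    have hrm := rearr_measurable volume g
    have hXfin : X ≠ ⊤ := by
      apply ne_of_lt
      calc X ≤ ∫⁻ t in Ioi (0:ℝ), (Ioc 0 (2 * |R|)).indicator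
              (fun t => (M:ℝ≥0∞) ^ 2 * ENNReal.ofReal t ^ (-(2 * s))) t := by
            apply setLIntegral_mono' measurableSet_Ioi
            intro t ht
            by_cases h : t ≤ 2 * |R|
            · rw [indicator_of_mem (show t ∈ Ioc 0 (2 * |R|) from ⟨ht, h⟩), mul_comm]
              gcongr
              exact min_le_right _ _
            · rw [hvan t (le_of_lt (not_le.mp h))]; simp
        _ ≤ ∫⁻ t, (Ioc 0 (2 * |R|)).indicator
              (fun t => (M:ℝ≥0∞) ^ 2 * ENNReal.ofReal t ^ (-(2 * s))) t :=
            setLIntegral_le_lintegral _ _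
        _ = (M:ℝ≥0∞) ^ 2 * ENNReal.ofReal ((2 * |R|) ^ (-(2 * s) + 1) / (-(2 * s) + 1)) := by
            rw [lintegral_indicator measurableSet_Ioc, lintegral_const_mul _ (by fun_prop),
              lintegral_pow_Ioc _ _ (by linarith) (by positivity)]
        _ < ⊤ := ENNReal.mul_lt_top (ENNReal.pow_lt_top (ENNReal.natCast_lt_top M))
              ENNReal.ofReal_lt_top
    have hscale : ∫⁻ t in Ioi (0:ℝ), ENNReal.ofReal t ^ (-(2 * s)) *
        (2 * (min (rearr volume g (l * t)) M) ^ 2) = ENNReal.ofReal (1 / 2) * X := by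
      have h1 := lintegral_Ioi_scale l hl0 (fun t => ENNReal.ofReal t ^ (-(2 * s)) *
        (min (rearr volume g t) M) ^ 2)
      rw [← hX] at h1
      have h2 : ∀ t ∈ Ioi (0:ℝ), ENNReal.ofReal t ^ (-(2 * s)) *
          (2 * (min (rearr volume g (l * t)) M) ^ 2) = ENNReal.ofReal (2 * l ^ (2 * s)) *
          (ENNReal.ofReal (l * t) ^ (-(2 * s)) * (min (rearr volume g (l * t)) M) ^ 2) := by
        intro t ht
        rw [ofReal_rpow_mul l hl0 t _ ht, ← mul_assoc, ← mul_assoc, ← mul_assoc,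
          ← ENNReal.ofReal_mul (by positivity), mul_assoc 2, ← Real.rpow_add hl0]
        simp [mul_comm]
      rw [setLIntegral_congr_fun measurableSet_Ioi h2, lintegral_const_mul _ (by fun_prop), h1,
        ← mul_assoc, ← ENNReal.ofReal_mul (by positivity)]
      congr 2
      rw [mul_assoc, ← Real.rpow_neg_one l, ← Real.rpow_add hl0, ← sub_eq_add_neg, hls]
      norm_num
    have hle : X ≤ ENNReal.ofReal (1 / 2) * X + ENNReal.ofReal c1 * W := by
      rw [← hscale]
      refine le_trans ?_ (add_le_add_right htail _)
      rw [← lintegral_add_left (by fun_prop)]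
      apply setLIntegral_mono' measurableSet_Ioi
      intro t ht
      rw [← mul_add]
      gcongr
      have hst := core_step g hg D hD hgD l t hl0 ht
      calc (min (rearr volume g t) M) ^ 2
          ≤ (min (rearr volume g (l * t)) M + J t ^ (1 / 2 : ℝ)) ^ 2 := by
            gcongr
            rw [min_add]
            exact min_le_min hst le_self_add
        _ ≤ _ := ennreal_add_sq_le _ _
        _ = _ := by
            congr 2
            rw [← ENNReal.rpow_two, ← ENNReal.rpow_mul]; norm_num
    have hhalf : ENNReal.ofReal (1 / 2) * X + ENNReal.ofReal (1 / 2) * X = X := by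
      rw [← add_mul, ← ENNReal.ofReal_add (by norm_num) (by norm_num)]; norm_num
    have hfin2 : ENNReal.ofReal (1 / 2) * X ≠ ⊤ := ENNReal.mul_ne_top ENNReal.ofReal_ne_top hXfin
    have h3 : ENNReal.ofReal (1 / 2) * X ≤ ENNReal.ofReal c1 * W := by
      rw [← ENNReal.add_le_add_iff_left hfin2, hhalf]; exact hle
    calc X = ENNReal.ofReal (1 / 2) * X + ENNReal.ofReal (1 / 2) * X := hhalf.symm
      _ ≤ ENNReal.ofReal c1 * W + ENNReal.ofReal c1 * W := add_le_add h3 h3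
      _ = _ := by rw [← add_mul, ← ENNReal.ofReal_add hc1p.le hc1p.le, two_mul]
  have hsup : ∀ t, ENNReal.ofReal t ^ (-(2 * s)) * rearr volume g t ^ 2 =
      ⨆ M : ℕ, ENNReal.ofReal t ^ (-(2 * s)) * (min (rearr volume g t) M) ^ 2 := by
    intro t
    have hmono : Monotone (fun M : ℕ => min (rearr volume g t) (M : ℝ≥0∞)) := by
      intro a b hab
      exact min_le_min le_rfl (by exact_mod_cast hab)
    rw [← ENNReal.mul_iSup, ← ENNReal.iSup_pow]
    congr 2
    have : (⨆ M : ℕ, min (rearr volume g t) (M : ℝ≥0∞)) = rearr volume g t ⊓ ⨆ M : ℕ, (M : ℝ≥0∞) :=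
      (inf_iSup_eq _ _).symm
    rw [this, ENNReal.iSup_natCast]; simp
  simp_rw [hsup]
  rw [lintegral_iSup]
  · exact iSup_le htrunc
  · intro M
    have hrm := rearr_measurable volume g
    fun_prop
  · intro a b hab t
    dsimp only
    gcongr

/-! ### Lorentz estimates -/

lemma lorentz_two_eq (P : ℝ≥0∞) (u : ℝ → ℝ≥0∞) (e : ℝ) (he : P⁻¹.toReal = e) :
    lorentzNorm volume P 2 u = (∫⁻ t in Ioi (0:ℝ),
      ENNReal.ofReal t ^ (2 * e - 1) * rearr volume u t ^ 2) ^ (1 / 2 : ℝ) := by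
  unfold lorentzNorm
  rw [if_neg (by simp), he]
  have : (2 : ℝ≥0∞)⁻¹.toReal = 1 / 2 := by simp
  rw [this]
  congr 1
  apply setLIntegral_congr_fun measurableSet_Ioi
  intro t ht
  have ht' : (0:ℝ) < t := ht
  have h0 : ENNReal.ofReal t ≠ 0 := by simpa using ht'
  dsimp only
  rw [show (2 : ℝ≥0∞).toReal = 2 by simp, ENNReal.mul_rpow_of_nonneg _ _ (by norm_num),
    ENNReal.rpow_two (rearr volume u t), ← ENNReal.rpow_mul, div_eq_mul_inv, mul_right_comm,
    ← ENNReal.rpow_neg_one, ← ENNReal.rpow_add _ _ h0 ENNReal.ofReal_ne_top]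
  congr 2
  ring

lemma lorentz_le (θ a : ℝ) (ha : 0 ≤ a) (hs0 : 0 < θ / 2 + a)
    (hs : θ / 2 + a < 1 / 2) : ∃ C : ℝ, 0 < C ∧
    ∀ (P : ℝ≥0∞), P⁻¹.toReal = (1 - θ) / 2 →
    ∀ (g : ℝ → ℝ≥0∞) (D : ℝ → ℝ → ℝ≥0∞) (R : ℝ), Measurable g →
    Measurable (Function.uncurry D) → (∀ h x, g x ≤ g (x + h) + D h x) →
    (∀ x, R < |x| → g x = 0) →
    ∀ (c : ℝ≥0∞) (u : ℝ → ℝ≥0∞), (∀ x, u x ≤ c * (ENNReal.ofReal |x| ^ (-a) * g x)) →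
    lorentzNorm volume P 2 u ≤ ENNReal.ofReal C * (c *
        (∫⁻ h in Ioi (0:ℝ), ENNReal.ofReal h ^ (-1 - 2 * (θ / 2 + a)) * ∫⁻ x, D h x ^ 2)
          ^ (1 / 2 : ℝ)) := by
  obtain ⟨C, hC, hmain⟩ := core_rearr (θ / 2 + a) hs0 hs
  set K : ℝ := (4⁻¹ ^ (-a)) ^ 2 * (2⁻¹ ^ (θ + 2 * a) * 2) * C with hK
  have hKp : 0 < K := by positivity
  refine ⟨K ^ (1 / 2 : ℝ), by positivity, ?_⟩
  intro P hP g D R hg hD hgD hR c u hu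
  have hm := hmain g D R hg hD hgD hR
  set W := ∫⁻ h in Ioi (0:ℝ), ENNReal.ofReal h ^ (-1 - 2 * (θ / 2 + a)) * ∫⁻ x, D h x ^ 2
  have hrm := rearr_measurable volume g
  rw [lorentz_two_eq P u _ hP]
  have hmain2 : ∫⁻ t in Ioi (0:ℝ), ENNReal.ofReal t ^ (2 * ((1 - θ) / 2) - 1) *
      rearr volume u t ^ 2 ≤ ENNReal.ofReal K * (c ^ 2 * W) := by
    calc _ ≤ ∫⁻ t in Ioi (0:ℝ), (c ^ 2 * ENNReal.ofReal ((4⁻¹ ^ (-a)) ^ 2 * (2⁻¹ ^ (θ + 2 * a)))) *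
          (ENNReal.ofReal (2⁻¹ * t) ^ (-(2 * (θ / 2 + a))) * rearr volume g (2⁻¹ * t) ^ 2) := by
          apply setLIntegral_mono' measurableSet_Ioi
          intro t ht
          have ht' : (0:ℝ) < t := ht
          have h0 : ENNReal.ofReal t ≠ 0 := by simpa using ht'
          have h1 : rearr volume u t ≤ c * (ENNReal.ofReal (t / 4) ^ (-a) *
              rearr volume g (t / 2)) :=
            (rearr_mono volume hu t).trans ((rearr_const_mul volume _ c t).trans
              (mul_le_mul_right (rearr_weight a ha g t ht) _))
          rw [show t / 4 = 4⁻¹ * t by ring, show t / 2 = 2⁻¹ * t by ring,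
            ofReal_rpow_mul _ (by norm_num) _ _ ht'] at h1
          rw [ofReal_rpow_mul _ (by norm_num) _ _ ht']
          refine (mul_le_mul_right (pow_le_pow_left' h1 2) _).trans (le_of_eq ?_)
          have e1 : ENNReal.ofReal t ^ (-(2 * (θ / 2 + a))) =
              ENNReal.ofReal t ^ (2 * ((1 - θ) / 2) - 1) * (ENNReal.ofReal t ^ (-a)) ^ 2 := by
            rw [← ENNReal.rpow_two, ← ENNReal.rpow_mul,
              ← ENNReal.rpow_add _ _ h0 ENNReal.ofReal_ne_top]
            congr 1; ring
          have e2 : ENNReal.ofReal ((4⁻¹ ^ (-a)) ^ 2 * (2⁻¹ ^ (θ + 2 * a))) *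
              ENNReal.ofReal (2⁻¹ ^ (-(2 * (θ / 2 + a)))) = ENNReal.ofReal (4⁻¹ ^ (-a)) ^ 2 := by
            rw [← ENNReal.ofReal_mul (by positivity), mul_assoc, ← Real.rpow_add (by norm_num),
              ← ENNReal.ofReal_pow (by positivity),
              show θ + 2 * a + -(2 * (θ / 2 + a)) = 0 by ring]
            simp
          rw [e1]
          calc _ = c ^ 2 * ENNReal.ofReal (4⁻¹ ^ (-a)) ^ 2 *
              ENNReal.ofReal t ^ (2 * ((1 - θ) / 2) - 1) * (ENNReal.ofReal t ^ (-a)) ^ 2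
                * rearr volume g (2⁻¹ * t) ^ 2 := by ring
            _ = _ := by rw [← e2]; ring
      _ = (c ^ 2 * ENNReal.ofReal ((4⁻¹ ^ (-a)) ^ 2 * (2⁻¹ ^ (θ + 2 * a)))) *
          (ENNReal.ofReal 2⁻¹⁻¹ * ∫⁻ t in Ioi (0:ℝ),
            (ENNReal.ofReal t ^ (-(2 * (θ / 2 + a))) * rearr volume g t ^ 2)) := by
          rw [lintegral_const_mul _ (by fun_prop), lintegral_Ioi_scale 2⁻¹ (by norm_num)
            (fun t => ENNReal.ofReal t ^ (-(2 * (θ / 2 + a))) * rearr volume g t ^ 2)]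
      _ ≤ (c ^ 2 * ENNReal.ofReal ((4⁻¹ ^ (-a)) ^ 2 * (2⁻¹ ^ (θ + 2 * a)))) *
          (ENNReal.ofReal 2⁻¹⁻¹ * (ENNReal.ofReal C * W)) := by gcongr
      _ = _ := by
          rw [hK, inv_inv, ENNReal.ofReal_mul (q := C) (by positivity),
            ← mul_assoc (_ ^ 2) _ (2:ℝ), ENNReal.ofReal_mul (q := 2) (by positivity)]
          ring
  calc _ ≤ (ENNReal.ofReal K * (c ^ 2 * W)) ^ (1 / 2 : ℝ) :=
        ENNReal.rpow_le_rpow hmain2 (by norm_num)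
    _ = _ := by
        rw [ENNReal.mul_rpow_of_nonneg _ _ (by norm_num),
          ENNReal.mul_rpow_of_nonneg _ _ (by norm_num), ENNReal.ofReal_rpow_of_pos hKp,
          ← ENNReal.rpow_two, ← ENNReal.rpow_mul]
        norm_num

/-- The weighted measure `h^{-1-2s} dh` on the half line. -/
def nuM (s : ℝ) : Measure ℝ :=
  (volume.restrict (Ioi (0:ℝ))).withDensity (fun h => ENNReal.ofReal h ^ (-1 - 2 * s))

instance (s : ℝ) : SFinite (nuM s) := by unfold nuM; infer_instance

lemma lintegral_nuM (s : ℝ) (φ : ℝ → ℝ≥0∞) (hφ : Measurable φ) :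
    ∫⁻ h, φ h ∂(nuM s) = ∫⁻ h in Ioi (0:ℝ), ENNReal.ofReal h ^ (-1 - 2 * s) * φ h := by
  unfold nuM
  rw [lintegral_withDensity_eq_lintegral_mul _ (by fun_prop) hφ]
  rfl

/-- Vector-valued one-dimensional step. -/
lemma lorentz_vec (θ a : ℝ) (ha : 0 ≤ a) (hs0 : 0 < θ / 2 + a)
    (hs : θ / 2 + a < 1 / 2) : ∃ C : ℝ, 0 < C ∧
    ∀ (P : ℝ≥0∞), P⁻¹.toReal = (1 - θ) / 2 →
    ∀ {H X : Type} [MeasurableSpace H] [MeasurableSpace X] (μ : Measure H) (m : Measure X)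
      [SFinite μ] [SFinite m] (F : ℝ → H → X → ℝ) (R : ℝ),
    Measurable (fun q : ℝ × H × X => F q.1 q.2.1 q.2.2) →
    (∀ x, R < |x| → ∀ a b, F x a b = 0) →
    ∀ (c : ℝ≥0∞) (u : ℝ → ℝ≥0∞), (∀ x, u x ≤ c * (ENNReal.ofReal |x| ^ (-a) *
      (∫⁻ a, ∫⁻ b, ‖F x a b‖ₑ ^ 2 ∂m ∂μ) ^ (1 / 2 : ℝ))) →
    lorentzNorm volume P 2 u ≤ ENNReal.ofReal C * (c *
        (∫⁻ a, ∫⁻ b, ‖F (b.1 + a.1) a.2 b.2 - F b.1 a.2 b.2‖ₑ ^ 2 ∂(volume.prod m)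
          ∂((nuM (θ / 2 + a)).prod μ)) ^ (1 / 2 : ℝ)) := by
  obtain ⟨C, hC, hmain⟩ := lorentz_le θ a ha hs0 hs
  refine ⟨C, hC, ?_⟩
  intro P hP H X _ _ μ m _ _ F R hF hR c u hu
  have hF2 : ∀ x, Measurable (fun z : H × X => F x z.1 z.2) := fun x =>
    hF.comp (measurable_const.prodMk measurable_id)
  have hFadd : Measurable (fun q : (ℝ × ℝ) × H × X => F (q.1.2 + q.1.1) q.2.1 q.2.2) :=
    hF.comp (f := fun q : (ℝ × ℝ) × H × X => (q.1.2 + q.1.1, q.2.1, q.2.2)) (by fun_prop)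
  have hFx : Measurable (fun q : (ℝ × ℝ) × H × X => F (q.1.2) q.2.1 q.2.2) :=
    hF.comp (f := fun q : (ℝ × ℝ) × H × X => (q.1.2, q.2.1, q.2.2)) (by fun_prop)
  have hΔ : Measurable (fun q : (ℝ × ℝ) × H × X =>
      ‖F (q.1.2 + q.1.1) q.2.1 q.2.2 - F q.1.2 q.2.1 q.2.2‖ₑ ^ 2) :=
    ((hFadd.sub hFx).enorm).pow_const 2
  set g : ℝ → ℝ≥0∞ := fun x => (∫⁻ z, ‖F x z.1 z.2‖ₑ ^ 2 ∂(μ.prod m)) ^ (1 / 2 : ℝ) with hg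
  set D : ℝ → ℝ → ℝ≥0∞ := fun h x =>
    (∫⁻ z, ‖F (x + h) z.1 z.2 - F x z.1 z.2‖ₑ ^ 2 ∂(μ.prod m)) ^ (1 / 2 : ℝ) with hD
  have hgm : Measurable g :=
    Measurable.pow_const (Measurable.lintegral_prod_right' (f := fun q : ℝ × H × X =>
      ‖F q.1 q.2.1 q.2.2‖ₑ ^ 2) ((hF.enorm).pow_const 2)) _
  have hDm : Measurable (Function.uncurry D) :=
    Measurable.pow_const (Measurable.lintegral_prod_right' hΔ) _
  have htri : ∀ h x, g x ≤ g (x + h) + D h x := by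
    intro h x
    simp only [hg, hD]
    have h1 := ENNReal.lintegral_Lp_add_le (μ := μ.prod m) (p := 2)
      (f := fun z => ‖F (x + h) z.1 z.2‖ₑ) (g := fun z => ‖F (x + h) z.1 z.2 - F x z.1 z.2‖ₑ)
      (hF2 _).enorm.aemeasurable ((hF2 _).sub (hF2 _)).enorm.aemeasurable (by norm_num)
    simp only [Pi.add_apply, ENNReal.rpow_two] at h1
    refine le_trans ?_ h1
    gcongr with z
    calc ‖F x z.1 z.2‖ₑ = ‖F (x + h) z.1 z.2 - (F (x + h) z.1 z.2 - F x z.1 z.2)‖ₑ := by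
          congr 1; ring
      _ ≤ _ := enorm_sub_le
  have hgz : ∀ x, R < |x| → g x = 0 := by
    intro x hx
    simp [hg, hR x hx]
  have hge : ∀ x, (∫⁻ a, ∫⁻ b, ‖F x a b‖ₑ ^ 2 ∂m ∂μ) ^ (1 / 2 : ℝ) = g x := by
    intro x
    simp only [hg]
    rw [lintegral_prod _ ((hF2 x).enorm.pow_const 2).aemeasurable]
  have hres := hmain P hP g D R hgm hDm htri hgz c u (fun x => by rw [← hge]; exact hu x)
  refine hres.trans (le_of_eq ?_)
  congr 3
  have hD2 : ∀ h x, D h x ^ 2 =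
      ∫⁻ z, ‖F (x + h) z.1 z.2 - F x z.1 z.2‖ₑ ^ 2 ∂(μ.prod m) := by
    intro h x
    simp only [hD]
    rw [← ENNReal.rpow_two, ← ENNReal.rpow_mul]; norm_num
  -- joint measurability in the variables (h, a, x, b)
  have hΔ2 : Measurable (fun q : (ℝ × H) × ℝ × X =>
      ‖F (q.2.1 + q.1.1) q.1.2 q.2.2 - F q.2.1 q.1.2 q.2.2‖ₑ ^ 2) :=
    hΔ.comp (g := fun q : (ℝ × ℝ) × H × X =>
      ‖F (q.1.2 + q.1.1) q.2.1 q.2.2 - F q.1.2 q.2.1 q.2.2‖ₑ ^ 2)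
      (f := fun q : (ℝ × H) × ℝ × X => ((q.1.1, q.2.1), q.1.2, q.2.2)) (by fun_prop)
  rw [lintegral_prod _ (Measurable.lintegral_prod_right' hΔ2).aemeasurable]
  rw [lintegral_nuM _ _ (Measurable.lintegral_prod_right'
    (Measurable.lintegral_prod_right' hΔ2))]
  congr 1
  ext h
  congr 1
  simp_rw [hD2]
  have hA : ∀ x, Measurable (fun z : H × X => ‖F (x + h) z.1 z.2 - F x z.1 z.2‖ₑ ^ 2) :=
    fun x => ((hF2 _).sub (hF2 _)).enorm.pow_const 2
  have hB : ∀ y, Measurable (fun z : ℝ × X => ‖F (z.1 + h) y z.2 - F z.1 y z.2‖ₑ ^ 2) :=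
    fun y => hΔ2.comp (f := fun z : ℝ × X => ((h, y), z.1, z.2)) (by fun_prop)
  have e1 : ∀ x, ∫⁻ z, ‖F (x + h) z.1 z.2 - F x z.1 z.2‖ₑ ^ 2 ∂(μ.prod m) =
      ∫⁻ y, ∫⁻ w, ‖F (x + h) y w - F x y w‖ₑ ^ 2 ∂m ∂μ := fun x =>
    lintegral_prod _ (hA x).aemeasurable
  have e2 : ∀ y, ∫⁻ z : ℝ × X, ‖F (z.1 + h) y z.2 - F z.1 y z.2‖ₑ ^ 2 ∂(volume.prod m) =
      ∫⁻ x, ∫⁻ w, ‖F (x + h) y w - F x y w‖ₑ ^ 2 ∂m := fun y =>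
    lintegral_prod _ (hB y).aemeasurable
  simp_rw [e1, e2]
  apply lintegral_lintegral_swap
  apply Measurable.aemeasurable
  exact Measurable.lintegral_prod_right' (f := fun q : (ℝ × H) × X =>
    ‖F (q.1.1 + h) q.1.2 q.2 - F q.1.1 q.1.2 q.2‖ₑ ^ 2)
    (hΔ2.comp (f := fun q : (ℝ × H) × X => ((h, q.1.2), q.1.1, q.2)) (by fun_prop))

/-- The case of an unweighted `L²` norm. -/
lemma lorentz_vec_L2 (P : ℝ≥0∞) (hP : P⁻¹.toReal = 1 / 2)
    {H X : Type} [MeasurableSpace H] [MeasurableSpace X] (μ : Measure H) (m : Measure X)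
      [SFinite μ] [SFinite m] (F : ℝ → H → X → ℝ)
    (hF : Measurable (fun q : ℝ × H × X => F q.1 q.2.1 q.2.2))
    (c : ℝ≥0∞) (u : ℝ → ℝ≥0∞)
    (hu : ∀ x, u x ≤ c * (∫⁻ a, ∫⁻ b, ‖F x a b‖ₑ ^ 2 ∂m ∂μ) ^ (1 / 2 : ℝ)) :
    lorentzNorm volume P 2 u ≤ c *
        (∫⁻ a, ∫⁻ b, ‖F b.1 a b.2‖ₑ ^ 2 ∂(volume.prod m) ∂μ) ^ (1 / 2 : ℝ) := by
  rw [lorentz_two_eq P u _ hP]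
  have hF2 : Measurable (fun q : (ℝ × H) × X => ‖F q.1.1 q.1.2 q.2‖ₑ ^ 2) :=
    (hF.comp (f := fun q : (ℝ × H) × X => (q.1.1, q.1.2, q.2)) (by fun_prop)).enorm.pow_const 2
  have hF3 : ∀ y, Measurable (fun z : ℝ × X => ‖F z.1 y z.2‖ₑ ^ 2) := fun y =>
    (hF.comp (f := fun z : ℝ × X => (z.1, y, z.2)) (by fun_prop)).enorm.pow_const 2
  have hF4 : Measurable (fun x : ℝ => ∫⁻ a, ∫⁻ b, ‖F x a b‖ₑ ^ 2 ∂m ∂μ) :=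
    Measurable.lintegral_prod_right' (Measurable.lintegral_prod_right' hF2)
  set g : ℝ → ℝ≥0∞ := fun x => (∫⁻ a, ∫⁻ b, ‖F x a b‖ₑ ^ 2 ∂m ∂μ) ^ (1 / 2 : ℝ) with hg
  have hgm : Measurable g := hF4.pow_const _
  have hg2 : ∀ x, g x ^ 2 = ∫⁻ a, ∫⁻ b, ‖F x a b‖ₑ ^ 2 ∂m ∂μ := by
    intro x
    simp only [hg]
    rw [← ENNReal.rpow_two, ← ENNReal.rpow_mul]; norm_num
  have h1 : ∫⁻ t in Ioi (0:ℝ), ENNReal.ofReal t ^ (2 * (1 / 2 : ℝ) - 1) * rearr volume u t ^ 2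
      ≤ c ^ 2 * ∫⁻ a, ∫⁻ b, ‖F b.1 a b.2‖ₑ ^ 2 ∂(volume.prod m) ∂μ := by
    calc _ ≤ ∫⁻ t in Ioi (0:ℝ), c ^ 2 * rearr volume g t ^ 2 := by
          apply lintegral_mono
          intro t
          dsimp only
          rw [show 2 * (1 / 2 : ℝ) - 1 = 0 by norm_num, ENNReal.rpow_zero, one_mul, ← mul_pow]
          gcongr
          exact (rearr_mono volume hu t).trans (rearr_const_mul volume g c t)
      _ = c ^ 2 * ∫⁻ t in Ioi (0:ℝ), rearr volume g t ^ 2 :=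
          lintegral_const_mul _ ((rearr_measurable volume g).pow_const 2)
      _ ≤ c ^ 2 * ∫⁻ x, g x ^ 2 := mul_le_mul_right (rearr_sq_le g hgm) _
      _ = _ := by
          congr 1
          simp_rw [hg2]
          rw [lintegral_lintegral_swap]
          · congr 1; ext y
            rw [lintegral_prod _ (hF3 y).aemeasurable]
          · exact (Measurable.lintegral_prod_right' hF2).aemeasurable
  calc _ ≤ (c ^ 2 * ∫⁻ a, ∫⁻ b, ‖F b.1 a b.2‖ₑ ^ 2 ∂(volume.prod m) ∂μ) ^ (1 / 2 : ℝ) :=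
        ENNReal.rpow_le_rpow h1 (by norm_num)
    _ = _ := by
        rw [ENNReal.mul_rpow_of_nonneg _ _ (by norm_num), ← ENNReal.rpow_two, ← ENNReal.rpow_mul]
        norm_num

/-! ### Integrals of minima -/

lemma min_integral (s κ : ℝ) (hs : 0 < s) (hκ : s < κ) : ∃ C : ℝ, 0 < C ∧
    ∀ X Y : ℝ≥0∞, X ≠ ⊤ → Y ≠ ⊤ →
    ∫⁻ h, (min X (ENNReal.ofReal |h| ^ 2 * Y)) ^ κ ∂(nuM s) ≤
      ENNReal.ofReal C * (X ^ (κ - s) * Y ^ s) := by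
  have hκ0 : 0 < κ := hs.trans hκ
  refine ⟨1 / (2 * (κ - s)) + 1 / (2 * s), by
    have : 0 < κ - s := by linarith
    positivity, ?_⟩
  intro X Y hX hY
  rw [lintegral_nuM _ _ (by fun_prop)]
  by_cases hX0 : X = 0
  · subst hX0; simp [hκ0]
  by_cases hY0 : Y = 0
  · subst hY0; simp [hκ0]
  have hx : 0 < X.toReal := ENNReal.toReal_pos hX0 hX
  have hy : 0 < Y.toReal := ENNReal.toReal_pos hY0 hY
  obtain ⟨x, rfl⟩ : ∃ x, X = ENNReal.ofReal x := ⟨_, (ENNReal.ofReal_toReal hX).symm⟩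
  obtain ⟨y, rfl⟩ : ∃ y, Y = ENNReal.ofReal y := ⟨_, (ENNReal.ofReal_toReal hY).symm⟩
  replace hx : 0 < x := by simpa using hX0
  replace hy : 0 < y := by simpa using hY0
  set h0 : ℝ := (x / y) ^ (1 / 2 : ℝ) with hh0
  have hh0p : 0 < h0 := by positivity
  have hκs : 0 < κ - s := by linarith
  rw [← Ioc_union_Ioi_eq_Ioi hh0p.le]
  refine (lintegral_union_le _ _ _).trans ?_
  have p1 : ∫⁻ h in Ioc 0 h0, ENNReal.ofReal h ^ (-1 - 2 * s) *
      (min (ENNReal.ofReal x) (ENNReal.ofReal |h| ^ 2 * ENNReal.ofReal y)) ^ κ ≤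
      ENNReal.ofReal (1 / (2 * (κ - s)) * (x ^ (κ - s) * y ^ s)) := by
    calc _ ≤ ∫⁻ h in Ioc 0 h0, ENNReal.ofReal (y ^ κ) * ENNReal.ofReal h ^ (-1 - 2 * s + 2 * κ) := by
          apply setLIntegral_mono' measurableSet_Ioc
          intro h hh
          have hp : 0 < h := hh.1
          rw [abs_of_pos hp]
          refine (mul_le_mul_right (ENNReal.rpow_le_rpow (min_le_right _ _) hκ0.le) _).trans ?_
          rw [ENNReal.mul_rpow_of_nonneg _ _ hκ0.le, ← ENNReal.rpow_two, ← ENNReal.rpow_mul,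
            ENNReal.ofReal_rpow_of_pos hy, ← mul_assoc,
            ← ENNReal.rpow_add _ _ (by simpa using hp) ENNReal.ofReal_ne_top, mul_comm]
      _ = ENNReal.ofReal (y ^ κ * (h0 ^ (2 * (κ - s)) / (2 * (κ - s)))) := by
          rw [lintegral_const_mul _ (by fun_prop), lintegral_pow_Ioc _ _ (by linarith) hh0p.le,
            ← ENNReal.ofReal_mul (by positivity)]
          congr 4 <;> ring_nf
      _ ≤ _ := by
          apply ENNReal.ofReal_le_ofReal
          apply le_of_eq
          rw [hh0, ← Real.rpow_mul (by positivity), show 1 / 2 * (2 * (κ - s)) = κ - s by ring,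
            Real.div_rpow hx.le hy.le, show s = κ - (κ - s) by ring, Real.rpow_sub hy]
          rw [show κ - (κ - (κ - s)) = κ - s by ring]
          field_simp
  have p2 : ∫⁻ h in Ioi h0, ENNReal.ofReal h ^ (-1 - 2 * s) *
      (min (ENNReal.ofReal x) (ENNReal.ofReal |h| ^ 2 * ENNReal.ofReal y)) ^ κ ≤
      ENNReal.ofReal (1 / (2 * s) * (x ^ (κ - s) * y ^ s)) := by
    calc _ ≤ ∫⁻ h in Ioi h0, ENNReal.ofReal (x ^ κ) * ENNReal.ofReal h ^ (-1 - 2 * s) := by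
          apply setLIntegral_mono' measurableSet_Ioi
          intro h hh
          refine (mul_le_mul_right (ENNReal.rpow_le_rpow (min_le_left _ _) hκ0.le) _).trans ?_
          rw [ENNReal.ofReal_rpow_of_pos hx, mul_comm]
      _ = ENNReal.ofReal (x ^ κ * (h0 ^ (-(2 * s)) / (2 * s))) := by
          rw [lintegral_const_mul _ (by fun_prop), lintegral_pow_Ioi _ _ (by linarith) hh0p,
            ← ENNReal.ofReal_mul (by positivity)]
          congr 2
          rw [show -1 - 2 * s + 1 = -(2 * s) by ring, neg_div_neg_eq]
      _ ≤ _ := by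
          apply ENNReal.ofReal_le_ofReal
          apply le_of_eq
          rw [hh0, ← Real.rpow_mul (by positivity), show 1 / 2 * (-(2 * s)) = -s by ring,
            Real.rpow_neg (by positivity), Real.div_rpow hx.le hy.le, Real.rpow_sub hx]
          field_simp
  refine (add_le_add p1 p2).trans ?_
  rw [← ENNReal.ofReal_add (by positivity) (by positivity), ENNReal.ofReal_rpow_of_pos hx,
    ENNReal.ofReal_rpow_of_pos hy, ← ENNReal.ofReal_mul (by positivity),
    ← ENNReal.ofReal_mul (by positivity)]
  apply ENNReal.ofReal_le_ofReal
  apply le_of_eq; ring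

lemma min_integral2 (s0 s1 : ℝ) (h0 : 0 < s0) (h1 : 0 < s1) (hs : s0 + s1 < 1) : ∃ C : ℝ, 0 < C ∧
    ∀ X Y : ℝ≥0∞, X ≠ ⊤ → Y ≠ ⊤ →
    ∫⁻ b, ∫⁻ c, (min (min X (ENNReal.ofReal |b| ^ 2 * Y)) (ENNReal.ofReal |c| ^ 2 * Y)) ∂(nuM s0)
      ∂(nuM s1) ≤ ENNReal.ofReal C * (X ^ (1 - (s0 + s1)) * Y ^ (s0 + s1)) := by
  obtain ⟨C0, hC0, H0⟩ := min_integral s0 1 h0 (by linarith)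
  obtain ⟨C1, hC1, H1⟩ := min_integral s1 (1 - s0) h1 (by linarith)
  refine ⟨C0 * C1, by positivity, ?_⟩
  intro X Y hX hY
  have hfin : ENNReal.ofReal C0 * Y ^ s0 ≠ ⊤ :=
    ENNReal.mul_ne_top ENNReal.ofReal_ne_top (ENNReal.rpow_ne_top_of_nonneg h0.le hY)
  calc _ ≤ ∫⁻ b, (ENNReal.ofReal C0 * Y ^ s0) *
          (min X (ENNReal.ofReal |b| ^ 2 * Y)) ^ (1 - s0) ∂(nuM s1) := by
        apply lintegral_mono
        intro b
        have := H0 (min X (ENNReal.ofReal |b| ^ 2 * Y)) Y (ne_top_of_le_ne_top hX (min_le_left _ _)) hY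
        simp only [ENNReal.rpow_one] at this
        refine this.trans (le_of_eq ?_)
        ring
    _ = (ENNReal.ofReal C0 * Y ^ s0) * ∫⁻ b,
          (min X (ENNReal.ofReal |b| ^ 2 * Y)) ^ (1 - s0) ∂(nuM s1) :=
        lintegral_const_mul' _ _ hfin
    _ ≤ (ENNReal.ofReal C0 * Y ^ s0) * (ENNReal.ofReal C1 * (X ^ (1 - s0 - s1) * Y ^ s1)) :=
        mul_le_mul_right (H1 X Y hX hY) _
    _ = _ := by
        rw [ENNReal.ofReal_mul hC0.le, ENNReal.rpow_add_of_nonneg _ _ h0.le h1.le,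
          show 1 - (s0 + s1) = 1 - s0 - s1 by ring]
        ring

lemma min_integral3 (s0 s1 s2 : ℝ) (h0 : 0 < s0) (h1 : 0 < s1) (h2 : 0 < s2)
    (hs : s0 + s1 + s2 < 1) : ∃ C : ℝ, 0 < C ∧
    ∀ X Y : ℝ≥0∞, X ≠ ⊤ → Y ≠ ⊤ →
    ∫⁻ a, ∫⁻ b, ∫⁻ c, (min (min (min X (ENNReal.ofReal |a| ^ 2 * Y)) (ENNReal.ofReal |b| ^ 2 * Y))
      (ENNReal.ofReal |c| ^ 2 * Y)) ∂(nuM s0) ∂(nuM s1) ∂(nuM s2) ≤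
      ENNReal.ofReal C * (X ^ (1 - (s0 + s1 + s2)) * Y ^ (s0 + s1 + s2)) := by
  obtain ⟨C0, hC0, H0⟩ := min_integral2 s0 s1 h0 h1 (by linarith)
  obtain ⟨C1, hC1, H1⟩ := min_integral s2 (1 - (s0 + s1)) h2 (by linarith)
  refine ⟨C0 * C1, by positivity, ?_⟩
  intro X Y hX hY
  have hfin : ENNReal.ofReal C0 * Y ^ (s0 + s1) ≠ ⊤ :=
    ENNReal.mul_ne_top ENNReal.ofReal_ne_top (ENNReal.rpow_ne_top_of_nonneg (by positivity) hY)
  calc _ ≤ ∫⁻ b, (ENNReal.ofReal C0 * Y ^ (s0 + s1)) *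
          (min X (ENNReal.ofReal |b| ^ 2 * Y)) ^ (1 - (s0 + s1)) ∂(nuM s2) := by
        apply lintegral_mono
        intro b
        have := H0 (min X (ENNReal.ofReal |b| ^ 2 * Y)) Y (ne_top_of_le_ne_top hX (min_le_left _ _)) hY
        refine this.trans (le_of_eq ?_)
        ring
    _ = (ENNReal.ofReal C0 * Y ^ (s0 + s1)) * ∫⁻ b,
          (min X (ENNReal.ofReal |b| ^ 2 * Y)) ^ (1 - (s0 + s1)) ∂(nuM s2) :=
        lintegral_const_mul' _ _ hfin
    _ ≤ (ENNReal.ofReal C0 * Y ^ (s0 + s1)) *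
          (ENNReal.ofReal C1 * (X ^ (1 - (s0 + s1) - s2) * Y ^ s2)) :=
        mul_le_mul_right (H1 X Y hX hY) _
    _ = _ := by
        rw [ENNReal.ofReal_mul hC0.le, ENNReal.rpow_add_of_nonneg (s0 + s1) _ (by positivity) h2.le,
          show 1 - (s0 + s1 + s2) = 1 - (s0 + s1) - s2 by ring]
        ring

/-! ### Difference operators -/

/-- Difference operator. -/
def dl (v : Fin 3 → ℝ) (f : (Fin 3 → ℝ) → ℝ) (x : Fin 3 → ℝ) : ℝ := f (x + v) - f x

lemma dl_cont (v : Fin 3 → ℝ) (f : (Fin 3 → ℝ) → ℝ) (hf : Continuous f) : Continuous (dl v f) := by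
  unfold dl; fun_prop

lemma dl_comm (v w : Fin 3 → ℝ) (f : (Fin 3 → ℝ) → ℝ) : dl v (dl w f) = dl w (dl v f) := by
  ext x
  simp only [dl]
  rw [show x + v + w = x + w + v by ring]; ring

lemma dl_four (v : Fin 3 → ℝ) (f : (Fin 3 → ℝ) → ℝ) (hf : Continuous f) :
    ∫⁻ x, ‖dl v f x‖ₑ ^ 2 ≤ 4 * ∫⁻ x, ‖f x‖ₑ ^ 2 := by
  calc _ ≤ ∫⁻ x, (2 * ‖f (x + v)‖ₑ ^ 2 + 2 * ‖f x‖ₑ ^ 2) := by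
        apply lintegral_mono
        intro x
        exact (pow_le_pow_left' enorm_sub_le 2).trans (ennreal_add_sq_le _ _)
    _ = _ := by
        have hm : Measurable f := hf.measurable
        rw [lintegral_add_left (by fun_prop), lintegral_const_mul _ (by fun_prop),
          lintegral_const_mul _ (by fun_prop),
          lintegral_add_right_eq_self (fun x => ‖f x‖ₑ ^ 2) v, ← add_mul]
        norm_num

lemma dl_grad (v : Fin 3 → ℝ) (f : (Fin 3 → ℝ) → ℝ) (hf : ContDiff ℝ 1 f) :
    ∫⁻ x, ‖dl v f x‖ₑ ^ 2 ≤ ENNReal.ofReal ‖v‖ ^ 2 * ∫⁻ x, ‖fderiv ℝ f x‖ₑ ^ 2 := by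
  have hcd : Continuous (fderiv ℝ f) := hf.continuous_fderiv (by norm_num)
  have hm : Measurable (fderiv ℝ f) := hcd.measurable
  have hpt : ∀ x, ‖dl v f x‖ₑ ^ 2 ≤ ENNReal.ofReal ‖v‖ ^ 2 *
      ∫⁻ t in Icc (0:ℝ) 1, ‖fderiv ℝ f (x + t • v)‖ₑ ^ 2 := by
    intro x
    have hder : ∀ t : ℝ, HasDerivAt (fun t : ℝ => f (x + t • v)) (fderiv ℝ f (x + t • v) v) t := by
      intro t
      have h1 : HasDerivAt (fun t : ℝ => x + t • v) v t := by
        simpa using ((hasDerivAt_id t).smul_const v).const_add x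
      exact ((hf.differentiable (by norm_num)) _).hasFDerivAt.comp_hasDerivAt t h1
    have hc : Continuous (fun t : ℝ => fderiv ℝ f (x + t • v) v) := by fun_prop
    have hint := intervalIntegral.integral_eq_sub_of_hasDerivAt (a := 0) (b := 1)
      (fun t _ => hder t) (hc.intervalIntegrable 0 1)
    have hdl : dl v f x = ∫ t in (0:ℝ)..1, fderiv ℝ f (x + t • v) v := by
      rw [hint]; simp [dl]
    have h2 : ‖dl v f x‖ₑ ≤ ENNReal.ofReal ‖v‖ *
        ∫⁻ t in Ioc (0:ℝ) 1, ‖fderiv ℝ f (x + t • v)‖ₑ := by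
      rw [hdl, intervalIntegral.integral_of_le zero_le_one, ← lintegral_const_mul _ (by fun_prop)]
      refine (enorm_integral_le_lintegral_enorm _).trans (lintegral_mono fun t => ?_)
      dsimp only
      rw [ofReal_norm, mul_comm]
      exact ContinuousLinearMap.le_opENorm _ _
    have h3 : (∫⁻ t in Ioc (0:ℝ) 1, ‖fderiv ℝ f (x + t • v)‖ₑ) ^ 2 ≤
        ∫⁻ t in Ioc (0:ℝ) 1, ‖fderiv ℝ f (x + t • v)‖ₑ ^ 2 := by
      have hh := ENNReal.lintegral_mul_le_Lp_mul_Lq (volume.restrict (Ioc (0:ℝ) 1))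
        Real.HolderConjugate.two_two
        (f := fun t => ‖fderiv ℝ f (x + t • v)‖ₑ) (g := fun _ => 1) (by fun_prop) (by fun_prop)
      simp only [Pi.mul_apply, mul_one, ENNReal.one_rpow, one_pow, lintegral_one, ENNReal.rpow_two,
        Measure.restrict_apply_univ, Real.volume_Ioc, sub_zero, ENNReal.ofReal_one] at hh
      calc _ ≤ ((∫⁻ t in Ioc (0:ℝ) 1, ‖fderiv ℝ f (x + t • v)‖ₑ ^ 2) ^ (1 / 2 : ℝ)) ^ 2 :=
            pow_le_pow_left' hh 2
        _ = _ := by rw [← ENNReal.rpow_two, ← ENNReal.rpow_mul]; norm_num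
    rw [← Measure.restrict_congr_set Ioc_ae_eq_Icc]
    calc _ ≤ (ENNReal.ofReal ‖v‖ * ∫⁻ t in Ioc (0:ℝ) 1, ‖fderiv ℝ f (x + t • v)‖ₑ) ^ 2 :=
          pow_le_pow_left' h2 2
      _ ≤ _ := by rw [mul_pow]; exact mul_le_mul_right h3 _
  have hjm : Measurable (fun q : (Fin 3 → ℝ) × ℝ => ‖fderiv ℝ f (q.1 + q.2 • v)‖ₑ ^ 2) :=
    (hm.comp (by fun_prop)).enorm.pow_const 2
  calc _ ≤ ∫⁻ x, ENNReal.ofReal ‖v‖ ^ 2 *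
      ∫⁻ t in Icc (0:ℝ) 1, ‖fderiv ℝ f (x + t • v)‖ₑ ^ 2 := lintegral_mono hpt
    _ = ENNReal.ofReal ‖v‖ ^ 2 * ∫⁻ x,
      ∫⁻ t in Icc (0:ℝ) 1, ‖fderiv ℝ f (x + t • v)‖ₑ ^ 2 :=
        lintegral_const_mul' _ _ (by simp)
    _ = _ := by
        rw [lintegral_lintegral_swap hjm.aemeasurable]
        congr 1
        calc _ = ∫⁻ t in Icc (0:ℝ) 1, ∫⁻ x, ‖fderiv ℝ f x‖ₑ ^ 2 := by
              congr 1; ext t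
              exact lintegral_add_right_eq_self (fun x => ‖fderiv ℝ f x‖ₑ ^ 2) (t • v)
          _ = _ := by simp

/-! ### Assembling -/

lemma lintegral_snoc (n : ℕ) (k : (Fin (n + 1) → ℝ) → ℝ≥0∞) (hk : Measurable k) :
    ∫⁻ x, k x = ∫⁻ t : ℝ, ∫⁻ y : Fin n → ℝ, k (Fin.snoc y t) := by
  have h := (volume_preserving_piFinSuccAbove (fun _ : Fin (n + 1) => ℝ) (Fin.last n)).symm
  rw [← h.lintegral_comp hk, Measure.volume_eq_prod, lintegral_prod _ (by
    exact (hk.comp (MeasurableEquiv.measurable _)).aemeasurable)]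
  congr 1; ext t; congr 1; ext y; congr 1
  simp [MeasurableEquiv.piFinSuccAbove, Fin.insertNthEquiv, Fin.insertNth_last']

lemma space_integral (k : (Fin 3 → ℝ) → ℝ≥0∞) (hk : Measurable k) :
    ∫⁻ b : ℝ × ℝ × ℝ × Unit, k ![b.2.2.1, b.2.1, b.1]
      ∂((volume : Measure ℝ).prod ((volume : Measure ℝ).prod ((volume : Measure ℝ).prod
        (Measure.dirac ())))) = ∫⁻ x, k x := by
  have hv : Measurable (fun b : ℝ × ℝ × ℝ × Unit => ![b.2.2.1, b.2.1, b.1]) := by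
    rw [measurable_pi_iff]; intro i; fin_cases i <;> simp <;> fun_prop
  have hsnoc : ∀ n, Measurable (fun q : ℝ × (Fin n → ℝ) => (Fin.snoc q.2 q.1 : Fin (n + 1) → ℝ)) := by
    intro n
    rw [measurable_pi_iff]
    intro i
    refine Fin.lastCases ?_ (fun j => ?_) i
    · simp; fun_prop
    · simp; fun_prop
  rw [lintegral_prod _ (by exact (hk.comp hv).aemeasurable), lintegral_snoc 2 k hk]
  congr 1; ext t
  have hk2 : Measurable (fun y : Fin 2 → ℝ => k (Fin.snoc y t)) :=
    hk.comp ((hsnoc 2).comp (f := fun y => (t, y)) (by fun_prop))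
  rw [lintegral_prod _ (by exact ((hk.comp hv).comp (f := fun b => (t, b)) (by fun_prop)).aemeasurable),
    lintegral_snoc 1 _ hk2]
  congr 1; ext u
  have hk1 : Measurable (fun y : Fin 1 → ℝ => k (Fin.snoc (Fin.snoc y u : Fin 2 → ℝ) t)) :=
    hk2.comp ((hsnoc 1).comp (f := fun y => (u, y)) (by fun_prop))
  rw [lintegral_prod _
    (by exact ((hk.comp hv).comp (f := fun b => (t, u, b)) (by fun_prop)).aemeasurable),
    lintegral_snoc 0 _ hk1]
  congr 1; ext w
  rw [lintegral_dirac, lintegral_unique]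
  have : (volume : Measure (Fin 0 → ℝ)) univ = 1 := by
    rw [volume_pi, Measure.pi_of_empty]; simp
  rw [this, mul_one]
  congr 1
  ext i; fin_cases i <;> rfl

lemma weight_bound (a : ℝ) (ha : 0 < a) (z x y : ℝ) :
    (‖z / ((x ^ 2 + y ^ 2) ^ a)‖₊ : ℝ≥0∞) ≤
      ENNReal.ofReal |y| ^ (-a) * (ENNReal.ofReal |x| ^ (-a) * ‖z‖ₑ) := by
  have hne : ∀ x : ℝ, ENNReal.ofReal |x| ^ (-a) ≠ 0 := by
    intro x
    rw [ENNReal.rpow_neg]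
    exact ENNReal.inv_ne_zero.mpr (ENNReal.rpow_ne_top_of_nonneg ha.le ENNReal.ofReal_ne_top)
  by_cases hz : z = 0
  · simp [hz]
  have hz' : ‖z‖ₑ ≠ 0 := by simpa using hz
  by_cases hx : x = 0
  · have : ENNReal.ofReal |x| ^ (-a) = ⊤ := by simp [hx, ha]
    rw [this, ENNReal.top_mul hz', ENNReal.mul_top (hne y)]; exact le_top
  by_cases hy : y = 0
  · have : ENNReal.ofReal |y| ^ (-a) = ⊤ := by simp [hy, ha]
    rw [this, ENNReal.top_mul (mul_ne_zero (hne x) hz')]; exact le_top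
  have hx' : 0 < |x| := abs_pos.mpr hx
  have hy' : 0 < |y| := abs_pos.mpr hy
  have h1 : |y| * |x| ≤ x ^ 2 + y ^ 2 := by
    nlinarith [sq_abs x, sq_abs y, sq_nonneg (|x| - |y|), mul_pos hx' hy']
  change ‖z / ((x ^ 2 + y ^ 2) ^ a)‖ₑ ≤ _
  rw [← ofReal_norm, ← ofReal_norm, ENNReal.ofReal_rpow_of_pos hx', ENNReal.ofReal_rpow_of_pos hy',
    ← ENNReal.ofReal_mul (by positivity), ← ENNReal.ofReal_mul (by positivity)]
  apply ENNReal.ofReal_le_ofReal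
  rw [norm_div, Real.norm_of_nonneg (r := (x ^ 2 + y ^ 2) ^ a) (by positivity), ← mul_assoc,
    ← Real.mul_rpow hy'.le hx'.le, Real.rpow_neg (by positivity), div_eq_inv_mul]
  gcongr

lemma eLpNorm_two_eq {E : Type*} [NormedAddCommGroup E] (f : (Fin 3 → ℝ) → E) :
    eLpNorm f 2 volume = (∫⁻ x, ‖f x‖ₑ ^ 2) ^ (1 / 2 : ℝ) := by
  rw [eLpNorm_eq_lintegral_rpow_enorm_toReal (by norm_num) (by norm_num)]
  simp

lemma exponent_eq (q : ℝ≥0∞) (hq : q⁻¹ ≤ 1) :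
    (2 / (1 - q⁻¹))⁻¹.toReal = (1 - q⁻¹.toReal) / 2 := by
  rw [ENNReal.inv_div (by simp) (by simp), ENNReal.toReal_div,
    ENNReal.toReal_sub_of_le hq (by simp)]
  simp

/-- Bound of third order differences. -/
lemma diff3 (f : (Fin 3 → ℝ) → ℝ) (hf : ContDiff ℝ 1 f) (a b c : ℝ) :
    ∫⁻ x, ‖dl ![0, 0, a] (dl ![0, b, 0] (dl ![c, 0, 0] f)) x‖ₑ ^ 2 ≤
      64 * min (min (min (∫⁻ x, ‖f x‖ₑ ^ 2)
        (ENNReal.ofReal |a| ^ 2 * ∫⁻ x, ‖fderiv ℝ f x‖ₑ ^ 2))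
        (ENNReal.ofReal |b| ^ 2 * ∫⁻ x, ‖fderiv ℝ f x‖ₑ ^ 2))
        (ENNReal.ofReal |c| ^ 2 * ∫⁻ x, ‖fderiv ℝ f x‖ₑ ^ 2) := by
  have hc := hf.continuous
  have two : ∀ u v (k : (Fin 3 → ℝ) → ℝ), Continuous k →
      ∫⁻ x, ‖dl u (dl v k) x‖ₑ ^ 2 ≤ 16 * ∫⁻ x, ‖k x‖ₑ ^ 2 := by
    intro u v k hk
    refine (dl_four u _ (dl_cont v k hk)).trans ?_
    refine (mul_le_mul_right (dl_four v k hk) _).trans (le_of_eq ?_)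
    rw [← mul_assoc]; norm_num
  have one : ∀ v r, ‖v‖ ≤ |r| → 16 * ∫⁻ x, ‖dl v f x‖ₑ ^ 2 ≤
      64 * (ENNReal.ofReal |r| ^ 2 * ∫⁻ x, ‖fderiv ℝ f x‖ₑ ^ 2) := by
    intro v r hv
    refine mul_le_mul' (by norm_num) ((dl_grad v f hf).trans ?_)
    gcongr
  have nv : ∀ (v : Fin 3 → ℝ) (r : ℝ), |v 0| ≤ |r| → |v 1| ≤ |r| → |v 2| ≤ |r| → ‖v‖ ≤ |r| := by
    intro v r h0 h1 h2
    rw [pi_norm_le_iff_of_nonneg (abs_nonneg r)]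
    intro i; fin_cases i
    · exact h0
    · exact h1
    · exact h2
  have m64 : ∀ s t : ℝ≥0∞, 64 * min s t = min (64 * s) (64 * t) := fun s t =>
    (mul_right_mono (a := (64 : ℝ≥0∞))).map_min
  rw [m64, m64, m64]
  refine le_min (le_min (le_min ?_ ?_) ?_) ?_
  · refine (dl_four _ _ (dl_cont _ _ (dl_cont _ _ hc))).trans ?_
    refine (mul_le_mul_right (two _ _ f hc) _).trans (le_of_eq ?_)
    rw [← mul_assoc]; norm_num
  · rw [dl_comm ![0, b, 0], dl_comm ![0, 0, a], dl_comm ![0, 0, a]]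
    refine (two _ _ _ (dl_cont _ _ hc)).trans (one _ a (nv _ _ ?_ ?_ ?_)) <;> simp
  · rw [dl_comm ![0, b, 0]]
    refine (two _ _ _ (dl_cont _ _ hc)).trans (one _ b (nv _ _ ?_ ?_ ?_)) <;> simp
  · refine (two _ _ _ (dl_cont _ _ hc)).trans (one _ c (nv _ _ ?_ ?_ ?_)) <;> simp

/-- Bound of second order differences. -/
lemma diff2 (f : (Fin 3 → ℝ) → ℝ) (hf : ContDiff ℝ 1 f) (b c : ℝ) :
    ∫⁻ x, ‖(dl ![0, b, 0] (dl ![c, 0, 0] f)) x‖ₑ ^ 2 ≤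
      64 * min (min (∫⁻ x, ‖f x‖ₑ ^ 2)
        (ENNReal.ofReal |b| ^ 2 * ∫⁻ x, ‖fderiv ℝ f x‖ₑ ^ 2))
        (ENNReal.ofReal |c| ^ 2 * ∫⁻ x, ‖fderiv ℝ f x‖ₑ ^ 2) := by
  have hc := hf.continuous
  have one : ∀ v r, ‖v‖ ≤ |r| → 4 * ∫⁻ x, ‖dl v f x‖ₑ ^ 2 ≤
      64 * (ENNReal.ofReal |r| ^ 2 * ∫⁻ x, ‖fderiv ℝ f x‖ₑ ^ 2) := by
    intro v r hv
    refine mul_le_mul' (by norm_num) ((dl_grad v f hf).trans ?_)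
    gcongr
  have nv : ∀ (v : Fin 3 → ℝ) (r : ℝ), |v 0| ≤ |r| → |v 1| ≤ |r| → |v 2| ≤ |r| → ‖v‖ ≤ |r| := by
    intro v r h0 h1 h2
    rw [pi_norm_le_iff_of_nonneg (abs_nonneg r)]
    intro i; fin_cases i
    · exact h0
    · exact h1
    · exact h2
  have m64 : ∀ s t : ℝ≥0∞, 64 * min s t = min (64 * s) (64 * t) := fun s t =>
    (mul_right_mono (a := (64 : ℝ≥0∞))).map_min
  rw [m64, m64]
  refine le_min (le_min ?_ ?_) ?_
  · refine (dl_four _ _ (dl_cont _ _ hc)).trans ?_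
    refine (mul_le_mul_right (dl_four _ f hc) _).trans ?_
    rw [← mul_assoc]
    exact mul_le_mul' (by norm_num) le_rfl
  · rw [dl_comm ![0, b, 0]]
    refine (dl_four _ _ (dl_cont _ _ hc)).trans (one _ b (nv _ _ ?_ ?_ ?_)) <;> simp
  · refine (dl_four _ _ (dl_cont _ _ hc)).trans (one _ c (nv _ _ ?_ ?_ ?_)) <;> simp

/-- Two inner steps: the bound of the two inner Lorentz norms. -/
lemma inner_two (θ0 θ1 a : ℝ) (ha : 0 < a) (h0 : 0 < θ0 / 2 + a) (h0' : θ0 / 2 + a < 1 / 2)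
    (h1 : 0 < θ1 / 2 + a) (h1' : θ1 / 2 + a < 1 / 2) : ∃ C : ℝ, 0 < C ∧
    ∀ (P0 P1 : ℝ≥0∞), P0⁻¹.toReal = (1 - θ0) / 2 → P1⁻¹.toReal = (1 - θ1) / 2 →
    ∀ (f : (Fin 3 → ℝ) → ℝ) (R : ℝ), Continuous f → (∀ x i, R < |x i| → f x = 0) →
    ∀ x2 : ℝ, lorentzNorm volume P1 2 (fun x1 => lorentzNorm volume P0 2 (fun x0 =>
      (‖f ![x0, x1, x2] / ((x0 ^ 2 + x1 ^ 2) ^ a)‖₊ : ℝ≥0∞))) ≤ ENNReal.ofReal C *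
      (∫⁻ h, ∫⁻ b, ‖dl ![0, h.1, 0] (dl ![h.2.1, 0, 0] f) ![b.2.1, b.1, x2]‖ₑ ^ 2
        ∂((volume : Measure ℝ).prod ((volume : Measure ℝ).prod (Measure.dirac ())))
        ∂((nuM (θ1 / 2 + a)).prod ((nuM (θ0 / 2 + a)).prod (Measure.dirac ())))) ^ (1 / 2 : ℝ) := by
  obtain ⟨C0, hC0, H0⟩ := lorentz_vec θ0 a ha.le h0 h0'
  obtain ⟨C1, hC1, H1⟩ := lorentz_vec θ1 a ha.le h1 h1'
  refine ⟨C1 * C0, by positivity, ?_⟩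
  intro P0 P1 hP0 hP1 f R hf hR x2
  have S0 := fun x1 : ℝ => H0 P0 hP0 (Measure.dirac ()) (Measure.dirac ())
    (fun x0 _ _ => f ![x0, x1, x2]) R
    (by
      have : Continuous (fun x0 : ℝ => f ![x0, x1, x2]) := by fun_prop
      exact this.measurable.comp measurable_fst)
    (fun x0 hx0 _ _ => hR _ 0 hx0) (ENNReal.ofReal |x1| ^ (-a))
    (fun x0 => (‖f ![x0, x1, x2] / ((x0 ^ 2 + x1 ^ 2) ^ a)‖₊ : ℝ≥0∞))
    (fun x0 => by
      simp only [lintegral_dirac]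
      rw [← ENNReal.rpow_two, ← ENNReal.rpow_mul]
      norm_num only
      rw [ENNReal.rpow_one]
      exact weight_bound a ha (f ![x0, x1, x2]) x0 x1)
  have S1 := H1 P1 hP1 ((nuM (θ0 / 2 + a)).prod (Measure.dirac ()))
    ((volume : Measure ℝ).prod (Measure.dirac ()))
    (fun x1 (h : ℝ × Unit) (b : ℝ × Unit) => f ![b.1 + h.1, x1, x2] - f ![b.1, x1, x2]) R
    (by
      apply Continuous.measurable
      fun_prop)
    (fun x1 hx1 h b => by rw [hR _ 1 hx1, hR _ 1 hx1, sub_zero]) (ENNReal.ofReal C0)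
    (fun x1 => lorentzNorm volume P0 2 (fun x0 =>
      (‖f ![x0, x1, x2] / ((x0 ^ 2 + x1 ^ 2) ^ a)‖₊ : ℝ≥0∞)))
    (fun x1 => S0 x1)
  refine S1.trans (le_of_eq ?_)
  rw [← mul_assoc, ENNReal.ofReal_mul hC1.le]
  congr 2
  refine lintegral_congr fun h => lintegral_congr fun b => ?_
  simp [dl]

theorem final_aux
    (α : ℝ) (hα0 : 0 ≤ α) (hα : α < 1 / 2) (θ : Fin 3 → ℝ) (P : Fin 3 → ℝ≥0∞)
    (hP : ∀ i, (P i)⁻¹.toReal = (1 - θ i) / 2)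
    (hθ0 : ∀ i, 0 ≤ θ i) (hθ : ∀ i, θ i < (1 - α) / 3) :
    ∃ C : ℝ, 0 < C ∧ ∀ f : (Fin 3 → ℝ) → ℝ,
      ContDiff ℝ (⊤ : ℕ∞) f → HasCompactSupport f →
      mixedLorentz 3 P (fun _ => 2)
          (fun x => (‖f x / ((x 0 ^ 2 + x 1 ^ 2) ^ ((1 + α) / 4))‖₊ : ℝ≥0∞))
        ≤ ENNReal.ofReal C *
          (eLpNorm f 2 volume ^ ((1 - α - ∑ i, θ i) / 2) *
            eLpNorm (fderiv ℝ f) 2 volume ^ ((1 + α + ∑ i, θ i) / 2)) := by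
  set a := (1 + α) / 4 with ha
  have ha0 : 0 < a := by rw [ha]; linarith
  have t0 := hθ0 0
  have t1 := hθ0 1
  have t2 := hθ0 2
  have u0 := hθ 0
  have u1 := hθ 1
  have u2 := hθ 2
  obtain ⟨C0, hC0, H0⟩ := inner_two (θ 0) (θ 1) a ha0 (by linarith) (by rw [ha]; linarith)
    (by linarith) (by rw [ha]; linarith)
  -- reduction to an integral estimate
  suffices hsuff : ∃ K : ℝ, 0 < K ∧ ∀ f : (Fin 3 → ℝ) → ℝ, ContDiff ℝ 1 f → HasCompactSupport f →
      (∫⁻ x, ‖f x‖ₑ ^ 2) ≠ ⊤ → (∫⁻ x, ‖fderiv ℝ f x‖ₑ ^ 2) ≠ ⊤ →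
      mixedLorentz 3 P (fun _ => 2)
          (fun x => (‖f x / ((x 0 ^ 2 + x 1 ^ 2) ^ a)‖₊ : ℝ≥0∞)) ≤
      ENNReal.ofReal K * ((∫⁻ x, ‖f x‖ₑ ^ 2) ^ ((1 - α - ∑ i, θ i) / 2) *
        (∫⁻ x, ‖fderiv ℝ f x‖ₑ ^ 2) ^ ((1 + α + ∑ i, θ i) / 2)) ^ (1 / 2 : ℝ) by
    obtain ⟨K, hK, hmain⟩ := hsuff
    refine ⟨K, hK, ?_⟩
    intro f hf hsupp
    have hf1 : ContDiff ℝ 1 f := hf.of_le (by exact_mod_cast le_top)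
    have fin1 : (∫⁻ x, ‖f x‖ₑ ^ 2) ≠ ⊤ := by
      have h := (hf1.continuous.memLp_of_hasCompactSupport (p := 2) (μ := volume) hsupp).2
      rw [eLpNorm_two_eq] at h
      intro h'
      rw [h'] at h; simp at h
    have fin2 : (∫⁻ x, ‖fderiv ℝ f x‖ₑ ^ 2) ≠ ⊤ := by
      have h := ((hf1.continuous_fderiv (by norm_num)).memLp_of_hasCompactSupport (p := 2)
        (μ := volume) (hsupp.fderiv (𝕜 := ℝ))).2
      rw [eLpNorm_two_eq] at h
      intro h'
      rw [h'] at h; simp at h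
    refine (hmain f hf1 hsupp fin1 fin2).trans (le_of_eq ?_)
    rw [eLpNorm_two_eq, eLpNorm_two_eq, ENNReal.mul_rpow_of_nonneg _ _ (by norm_num),
      ← ENNReal.rpow_mul, ← ENNReal.rpow_mul, ← ENNReal.rpow_mul, ← ENNReal.rpow_mul,
      mul_comm (1 / 2 : ℝ), mul_comm (1 / 2 : ℝ)]
  -- unfolding of the mixed norm
  have hunf : ∀ f : (Fin 3 → ℝ) → ℝ, mixedLorentz 3 P (fun _ => 2)
      (fun x => (‖f x / ((x 0 ^ 2 + x 1 ^ 2) ^ a)‖₊ : ℝ≥0∞)) =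
      lorentzNorm volume (P 2) 2 (fun x2 => lorentzNorm volume (P 1) 2 (fun x1 =>
        lorentzNorm volume (P 0) 2 (fun x0 =>
      (‖f ![x0, x1, x2] / ((x0 ^ 2 + x1 ^ 2) ^ a)‖₊ : ℝ≥0∞)))) := by
    intro f
    have e : ∀ x0 x1 x2 : ℝ, (Fin.cons x0 (Fin.cons x1 (Fin.cons x2 (fun i : Fin 0 => i.elim0)
        : Fin 1 → ℝ) : Fin 2 → ℝ) : Fin 3 → ℝ) = ![x0, x1, x2] := by
      intro x0 x1 x2
      ext i; fin_cases i <;> rfl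
    simp only [mixedLorentz, e]
    rfl
  have hRex : ∀ f : (Fin 3 → ℝ) → ℝ, HasCompactSupport f →
      ∃ R : ℝ, ∀ x i, R < |x i| → f x = 0 := by
    intro f hsupp
    obtain ⟨R, hR⟩ := hsupp.isBounded.subset_closedBall (0 : Fin 3 → ℝ)
    refine ⟨R, fun x i hx => ?_⟩
    by_contra hne
    have := hR (subset_tsupport f hne)
    rw [mem_closedBall_zero_iff] at this
    exact absurd ((norm_le_pi_norm x i).trans this) (not_le.mpr hx)
  have hmeas : ∀ k : (Fin 3 → ℝ) → ℝ, Continuous k → Measurable (fun x => ‖k x‖ₑ ^ 2) :=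
    fun k hk => hk.measurable.enorm.pow_const 2
  have hdlm : ∀ f : (Fin 3 → ℝ) → ℝ, Continuous f → Measurable
      (fun q : ℝ × (ℝ × ℝ × Unit) × (ℝ × ℝ × Unit) =>
        dl ![0, q.2.1.1, 0] (dl ![q.2.1.2.1, 0, 0] f) ![q.2.2.2.1, q.2.2.1, q.1]) := by
    intro f hf
    have h1 : Continuous (fun y : ℝ × ℝ × ℝ × ℝ × ℝ =>
        dl ![0, y.2.1, 0] (dl ![y.2.2.1, 0, 0] f) ![y.2.2.2.2, y.2.2.2.1, y.1]) := by
      simp only [dl]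
      fun_prop
    have h2 : Measurable (fun q : ℝ × (ℝ × ℝ × Unit) × (ℝ × ℝ × Unit) =>
        (q.1, q.2.1.1, q.2.1.2.1, q.2.2.1, q.2.2.2.1)) := by fun_prop
    exact h1.measurable.comp h2
  rw [Fin.sum_univ_three]
  by_cases hz : θ 2 = 0
  · -- L² in the last variable
    obtain ⟨C1, hC1, H1⟩ := min_integral2 (θ 0 / 2 + a) (θ 1 / 2 + a) (by linarith) (by linarith)
      (by rw [ha]; linarith)
    refine ⟨C0 * (64 * C1) ^ (1 / 2 : ℝ), by positivity, ?_⟩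
    intro f hf hsupp fin1 fin2
    obtain ⟨R, hR⟩ := hRex f hsupp
    have hfc := hf.continuous
    rw [hunf]
    have S := lorentz_vec_L2 (P 2) (by rw [hP, hz]; norm_num)
      ((nuM (θ 1 / 2 + a)).prod ((nuM (θ 0 / 2 + a)).prod (Measure.dirac ())))
      ((volume : Measure ℝ).prod ((volume : Measure ℝ).prod (Measure.dirac ())))
      (fun x2 h b => dl ![0, h.1, 0] (dl ![h.2.1, 0, 0] f) ![b.2.1, b.1, x2])
      (hdlm f hfc) (ENNReal.ofReal C0)
      (fun x2 => lorentzNorm volume (P 1) 2 (fun x1 =>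
        lorentzNorm volume (P 0) 2 (fun x0 =>
          (‖f ![x0, x1, x2] / ((x0 ^ 2 + x1 ^ 2) ^ a)‖₊ : ℝ≥0∞))))
      (fun x2 => H0 (P 0) (P 1) (hP 0) (hP 1) f R hfc hR x2)
    refine S.trans ?_
    rw [ENNReal.ofReal_mul hC0.le, mul_assoc]
    refine mul_le_mul_right ?_ _
    rw [← ENNReal.ofReal_rpow_of_pos (by positivity),
      ← ENNReal.mul_rpow_of_nonneg _ _ (by norm_num)]
    refine ENNReal.rpow_le_rpow ?_ (by norm_num)
    set A := ∫⁻ x, ‖f x‖ₑ ^ 2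
    set B := ∫⁻ x, ‖fderiv ℝ f x‖ₑ ^ 2
    calc _ ≤ ∫⁻ h : ℝ × ℝ × Unit, 64 * (min (min A (ENNReal.ofReal |h.1| ^ 2 * B))
          (ENNReal.ofReal |h.2.1| ^ 2 * B))
          ∂((nuM (θ 1 / 2 + a)).prod ((nuM (θ 0 / 2 + a)).prod (Measure.dirac ()))) := by
          apply lintegral_mono
          intro h
          refine le_trans (le_of_eq ?_) (diff2 f hf h.1 h.2.1)
          exact space_integral _ (hmeas _ (dl_cont _ _ (dl_cont _ _ hfc)))
      _ = 64 * ∫⁻ b, ∫⁻ c, (min (min A (ENNReal.ofReal |b| ^ 2 * B)) (ENNReal.ofReal |c| ^ 2 * B))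
            ∂(nuM (θ 0 / 2 + a)) ∂(nuM (θ 1 / 2 + a)) := by
          rw [lintegral_const_mul _ (by fun_prop), lintegral_prod _ (by fun_prop)]
          congr 1
          refine lintegral_congr fun b => ?_
          rw [lintegral_prod _ (by fun_prop)]
          simp
      _ ≤ 64 * _ := mul_le_mul_right (H1 A B fin1 fin2) _
      _ = _ := by
          rw [hz, ENNReal.ofReal_mul (by norm_num), ← mul_assoc]
          rw [show 1 - (θ 0 / 2 + a + (θ 1 / 2 + a)) = (1 - α - (θ 0 + θ 1 + 0)) / 2 by
              rw [ha]; ring,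
            show θ 0 / 2 + a + (θ 1 / 2 + a) = (1 + α + (θ 0 + θ 1 + 0)) / 2 by rw [ha]; ring]
          norm_num
  · have t2' : 0 < θ 2 := lt_of_le_of_ne t2 (Ne.symm hz)
    obtain ⟨C1, hC1, H1⟩ := min_integral3 (θ 0 / 2 + a) (θ 1 / 2 + a) (θ 2 / 2 + 0)
      (by linarith) (by linarith) (by linarith) (by rw [ha]; linarith)
    obtain ⟨C2, hC2, H2⟩ := lorentz_vec (θ 2) 0 le_rfl (by linarith) (by linarith)
    refine ⟨C2 * (C0 * (64 * C1) ^ (1 / 2 : ℝ)), by positivity, ?_⟩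
    intro f hf hsupp fin1 fin2
    obtain ⟨R, hR⟩ := hRex f hsupp
    have hfc := hf.continuous
    rw [hunf]
    have S := H2 (P 2) (hP 2)
      ((nuM (θ 1 / 2 + a)).prod ((nuM (θ 0 / 2 + a)).prod (Measure.dirac ())))
      ((volume : Measure ℝ).prod ((volume : Measure ℝ).prod (Measure.dirac ())))
      (fun x2 h b => dl ![0, h.1, 0] (dl ![h.2.1, 0, 0] f) ![b.2.1, b.1, x2]) R
      (hdlm f hfc)
      (fun x2 hx2 h b => by
        simp only [dl]
        rw [hR _ 2 (by simpa using hx2), hR _ 2 (by simpa using hx2),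
          hR _ 2 (by simpa using hx2), hR _ 2 (by simpa using hx2)]
        simp)
      (ENNReal.ofReal C0)
      (fun x2 => lorentzNorm volume (P 1) 2 (fun x1 =>
        lorentzNorm volume (P 0) 2 (fun x0 =>
          (‖f ![x0, x1, x2] / ((x0 ^ 2 + x1 ^ 2) ^ a)‖₊ : ℝ≥0∞))))
      (fun x2 => by
        rw [neg_zero, ENNReal.rpow_zero, one_mul]
        exact H0 (P 0) (P 1) (hP 0) (hP 1) f R hfc hR x2)
    refine S.trans ?_
    rw [ENNReal.ofReal_mul hC2.le, ENNReal.ofReal_mul hC0.le, mul_assoc, mul_assoc]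
    refine mul_le_mul_right (mul_le_mul_right ?_ _) _
    rw [← ENNReal.ofReal_rpow_of_pos (by positivity),
      ← ENNReal.mul_rpow_of_nonneg _ _ (by norm_num)]
    refine ENNReal.rpow_le_rpow ?_ (by norm_num)
    set A := ∫⁻ x, ‖f x‖ₑ ^ 2
    set B := ∫⁻ x, ‖fderiv ℝ f x‖ₑ ^ 2
    calc _ ≤ ∫⁻ h : ℝ × ℝ × ℝ × Unit, 64 * (min (min (min A (ENNReal.ofReal |h.1| ^ 2 * B))
          (ENNReal.ofReal |h.2.1| ^ 2 * B)) (ENNReal.ofReal |h.2.2.1| ^ 2 * B))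
          ∂((nuM (θ 2 / 2 + 0)).prod ((nuM (θ 1 / 2 + a)).prod ((nuM (θ 0 / 2 + a)).prod
            (Measure.dirac ())))) := by
          apply lintegral_mono
          intro h
          refine le_trans (le_of_eq ?_) (diff3 f hf h.1 h.2.1 h.2.2.1)
          rw [← space_integral _ (hmeas _ (dl_cont _ _ (dl_cont _ _ (dl_cont _ _ hfc))))]
          refine lintegral_congr fun b => ?_
          congr 2
          simp [dl]
      _ = 64 * ∫⁻ d, ∫⁻ b, ∫⁻ c, (min (min (min A (ENNReal.ofReal |d| ^ 2 * B))
            (ENNReal.ofReal |b| ^ 2 * B)) (ENNReal.ofReal |c| ^ 2 * B))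
            ∂(nuM (θ 0 / 2 + a)) ∂(nuM (θ 1 / 2 + a)) ∂(nuM (θ 2 / 2 + 0)) := by
          rw [lintegral_const_mul _ (by fun_prop), lintegral_prod _ (by fun_prop)]
          congr 1
          refine lintegral_congr fun d => ?_
          rw [lintegral_prod _ (by fun_prop)]
          refine lintegral_congr fun b => ?_
          rw [lintegral_prod _ (by fun_prop)]
          simp
      _ ≤ 64 * _ := mul_le_mul_right (H1 A B fin1 fin2) _
      _ = _ := by
          rw [ENNReal.ofReal_mul (by norm_num), ← mul_assoc]
          rw [show 1 - (θ 0 / 2 + a + (θ 1 / 2 + a) + (θ 2 / 2 + 0)) =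
              (1 - α - (θ 0 + θ 1 + θ 2)) / 2 by rw [ha]; ring,
            show θ 0 / 2 + a + (θ 1 / 2 + a) + (θ 2 / 2 + 0) =
              (1 + α + (θ 0 + θ 1 + θ 2)) / 2 by rw [ha]; ring]
          norm_num

/-- **Mixed Lorentz Hardy–Sobolev + Gagliardo–Nirenberg estimate with weight
`r^{-(1+α)/2}`.** For `0 ≤ α < 1/2` and `3/(1−α) < p_i ≤ ∞` with
`(1+α)/2 < (p_i−1)/p_i` for `i = 1,2` and `Σ 1/p_i ≤ 1−α`, one has, for all
`f ∈ C_0^∞(ℝ³)`,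
`‖ f / r^{(1+α)/2} ‖_{L^{2p_3/(p_3−1),2}_{x_3} L^{2p_2/(p_2−1),2}_{x_2} L^{2p_1/(p_1−1),2}_{x_1}}
  ≤ C ‖f‖_{L²}^{(1−α−Σ1/p_i)/2} ‖∇f‖_{L²}^{(1+α+Σ1/p_i)/2}`,
the Lorentz quasi-norm in `x_1` being taken innermost. Here the exponent
`2p_i/(p_i−1)` is expressed as `2/(1−1/p_i)` in `ℝ≥0∞` so as to allow `p_i = ∞`. -/
theorem mixed_lorentz_hardy_sobolev_GN_r_weight
    (α : ℝ) (hα0 : 0 ≤ α) (hα : α < 1 / 2) (p : Fin 3 → ℝ≥0∞)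
    (hp : ∀ i, ENNReal.ofReal (3 / (1 - α)) < p i)
    (hp01 : (1 + α) / 2 < 1 - (p 0)⁻¹.toReal)
    (hp02 : (1 + α) / 2 < 1 - (p 1)⁻¹.toReal)
    (hsum : (∑ i, (p i)⁻¹.toReal) ≤ 1 - α) :
    ∃ C : ℝ, 0 < C ∧ ∀ f : (Fin 3 → ℝ) → ℝ,
      ContDiff ℝ (⊤ : ℕ∞) f → HasCompactSupport f →
      mixedLorentz 3 (fun i => 2 / (1 - (p i)⁻¹)) (fun _ => 2)
          (fun x => (‖f x / ((x 0 ^ 2 + x 1 ^ 2) ^ ((1 + α) / 4))‖₊ : ℝ≥0∞))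
        ≤ ENNReal.ofReal C *
          (eLpNorm f 2 volume ^ ((1 - α - ∑ i, (p i)⁻¹.toReal) / 2) *
            eLpNorm (fderiv ℝ f) 2 volume ^ ((1 + α + ∑ i, (p i)⁻¹.toReal) / 2)) := by
  have h1 : ∀ i, (p i)⁻¹ < ENNReal.ofReal ((1 - α) / 3) := by
    intro i
    have h := ENNReal.inv_lt_inv.mpr (hp i)
    rwa [← ENNReal.ofReal_inv_of_pos (div_pos (by norm_num) (by linarith)), inv_div] at h
  have h2 : ∀ i, (p i)⁻¹ ≤ 1 := fun i => (h1 i).le.trans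
    (ENNReal.ofReal_le_one.mpr (by linarith))
  refine final_aux α hα0 hα (fun i => (p i)⁻¹.toReal) (fun i => 2 / (1 - (p i)⁻¹))
    (fun i => exponent_eq _ (h2 i)) (fun i => ENNReal.toReal_nonneg) (fun i => ?_)
  have h := ENNReal.toReal_lt_of_lt_ofReal (h1 i)
  exact h
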